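/- Let Γ be a Coxeter graph with vertex set S and let X, Y ⊆ S. Then the intersection of the standard parabolic subgroups VA_X[Γ] and VA_Y[Γ] of the virtual Artin group VA[Γ] equals the standard parabolic subgroup VA_{X∩Y}[Γ]. -/

import Mathlib

/-- The alternating product `a b a b ⋯` of length `m`. -/
def altProd {G : Type*} [Monoid G] (a b : G) (m : ℕ) : G :=
  ((List.range m).map (fun i => if i % 2 = 0 then a else b)).prod

/-- The defining relations of the virtual Artin group of a Coxeter matrix `M`.
The generator `Sum.inl s` plays the role of `σ_s` and `Sum.inr s` plays the role of `τ_s`.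
The value `M s t = 0` encodes `m_{s,t} = ∞`. -/
def vaRels {S : Type*} (M : CoxeterMatrix S) : Set (FreeGroup (S ⊕ S)) :=
  {r | ∃ s t : S, s ≠ t ∧ M s t ≠ 0 ∧
      r = altProd (FreeGroup.of (Sum.inl s)) (FreeGroup.of (Sum.inl t)) (M s t) *
        (altProd (FreeGroup.of (Sum.inl t)) (FreeGroup.of (Sum.inl s)) (M s t))⁻¹} ∪
  {r | ∃ s : S, r = FreeGroup.of (Sum.inr s) * FreeGroup.of (Sum.inr s)} ∪
  {r | ∃ s t : S, s ≠ t ∧ M s t ≠ 0 ∧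
      r = altProd (FreeGroup.of (Sum.inr s)) (FreeGroup.of (Sum.inr t)) (M s t) *
        (altProd (FreeGroup.of (Sum.inr t)) (FreeGroup.of (Sum.inr s)) (M s t))⁻¹} ∪
  {r | ∃ s t : S, s ≠ t ∧ M s t ≠ 0 ∧
      r = FreeGroup.of (Sum.inl s) *
          altProd (FreeGroup.of (Sum.inr t)) (FreeGroup.of (Sum.inr s)) (M s t - 1) *
        (altProd (FreeGroup.of (Sum.inr t)) (FreeGroup.of (Sum.inr s)) (M s t - 1) *
          FreeGroup.of (Sum.inl (if Even (M s t) then s else t)))⁻¹}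

/-- The virtual Artin group `VA[Γ]` of a Coxeter matrix. -/
def VirtualArtinGroup {S : Type*} (M : CoxeterMatrix S) : Type _ :=
  PresentedGroup (vaRels M)

instance {S : Type*} (M : CoxeterMatrix S) : Group (VirtualArtinGroup M) := by
  unfold VirtualArtinGroup; infer_instance

/-- The generator `σ_s` of the virtual Artin group. -/
def VirtualArtinGroup.sigma {S : Type*} (M : CoxeterMatrix S) (s : S) : VirtualArtinGroup M :=
  PresentedGroup.of (Sum.inl s)

/-- The generator `τ_s` of the virtual Artin group. -/
def VirtualArtinGroup.tau {S : Type*} (M : CoxeterMatrix S) (s : S) : VirtualArtinGroup M :=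
  PresentedGroup.of (Sum.inr s)

/-- The standard parabolic subgroup `VA_X[Γ]` of the virtual Artin group, generated by
`{σ_x | x ∈ X} ∪ {τ_x | x ∈ X}`. -/
def VirtualArtinGroup.parabolic {S : Type*} (M : CoxeterMatrix S) (X : Set S) :
    Subgroup (VirtualArtinGroup M) :=
  Subgroup.closure ((fun s => VirtualArtinGroup.sigma M s) '' X ∪
    (fun s => VirtualArtinGroup.tau M s) '' X)

open Polynomial.Chebyshev Module in
/-- The reflections in two vectors whose Gram entry is `-cos (π / m)` satisfy the braid relation
of order `m`. -/
theorem reflection_mul_reflection_pow_eq_one {V : Type*} [AddCommGroup V] [Module ℝ V]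
    {x y : V} {f g : Dual ℝ V} (hf : f x = 2) (hg : g y = 2) {m : ℕ} (hm : 2 ≤ m)
    (hy : f y = -2 * Real.cos (Real.pi / m)) (hx : g x = -2 * Real.cos (Real.pi / m)) :
    (reflection hf * reflection hg) ^ m = 1 := by
  have hm0 : (m : ℝ) ≠ 0 := by positivity
  set φ : ℝ := 2 * (Real.pi / m) with hφ
  have ht : 2 * Real.cos φ = f y * g x - 2 := by
    rw [hy, hx, hφ, Real.cos_two_mul]; ring
  have hmφ : (m : ℝ) * φ = 2 * Real.pi := by rw [hφ]; field_simp
  obtain rfl | hm3 := hm.eq_or_lt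
  · have hy0 : f y = 0 := by rw [hy]; simp
    have hx0 : g x = 0 := by rw [hx]; simp
    ext z
    simp only [pow_two, LinearEquiv.mul_apply, reflection_apply, LinearEquiv.coe_one, id_eq,
      map_sub, map_smul, hf, hg, hy0, hx0]
    module
  have hsin : Real.sin φ ≠ 0 := by
    apply ne_of_gt
    apply Real.sin_pos_of_pos_of_lt_pi
    · positivity
    · rw [hφ, ← mul_div_assoc, div_lt_iff₀ (by positivity), mul_comm]
      have : (2 : ℝ) < m := by exact_mod_cast hm3
      nlinarith [Real.pi_pos]
  have hS (n : ℤ) : (S ℝ n).eval (2 * Real.cos φ) = Real.sin ((n + 1) * φ) / Real.sin φ := by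
    rw [eq_div_iff hsin, S_two_mul_real_cos]
  have key : (S ℝ (((m : ℤ) - 2) / 2)).eval (2 * Real.cos φ) *
        ((S ℝ (((m : ℤ) - 1) / 2)).eval (2 * Real.cos φ) +
          (S ℝ (((m : ℤ) - 3) / 2)).eval (2 * Real.cos φ)) = 0 ∧
      (S ℝ (((m : ℤ) - 1) / 2)).eval (2 * Real.cos φ) *
        ((S ℝ ((m : ℤ) / 2)).eval (2 * Real.cos φ) +
          (S ℝ (((m : ℤ) - 2) / 2)).eval (2 * Real.cos φ)) = 0 := by
    obtain ⟨k, hk⟩ := Nat.even_or_odd' m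
    obtain hk | hk := hk
    · have h1 : ((m : ℤ) - 2) / 2 = k - 1 := by lia
      have h2 : ((m : ℤ) - 1) / 2 = k - 1 := by lia
      have h0 : (S ℝ ((k : ℤ) - 1)).eval (2 * Real.cos φ) = 0 := by
        rw [hS]
        have : (((k : ℤ) - 1 : ℤ) + 1 : ℝ) * φ = Real.pi := by
          have : (m : ℝ) = 2 * k := by exact_mod_cast hk
          rw [this] at hmφ
          push_cast
          linarith
        rw [this]; simp
      rw [h1, h2, h0]; simp
    · have h1 : ((m : ℤ) - 2) / 2 = k - 1 := by lia
      have h2 : ((m : ℤ) - 1) / 2 = k := by lia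
      have h3 : ((m : ℤ) - 3) / 2 = k - 1 := by lia
      have h4 : (m : ℤ) / 2 = k := by lia
      have h0 : (S ℝ (k : ℤ)).eval (2 * Real.cos φ) +
          (S ℝ ((k : ℤ) - 1)).eval (2 * Real.cos φ) = 0 := by
        rw [hS, hS]
        have : (((k : ℤ) : ℝ) + 1) * φ = 2 * Real.pi - (((k : ℤ) - 1 : ℤ) + 1 : ℝ) * φ := by
          have : (m : ℝ) = 2 * k + 1 := by exact_mod_cast hk
          rw [this] at hmφ
          push_cast
          linarith
        rw [this, Real.sin_two_pi_sub]
        ring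
      rw [h1, h2, h3, h4, h0]; simp
  ext z
  rw [reflection_mul_reflection_pow_apply hf hg m z _ ht, key.1, key.2]
  simp

open Polynomial.Chebyshev Module in
/-- The order of the product of the reflections in two linearly independent vectors whose Gram
entry is `-cos (π / m)` is a multiple of `m`. For `m = 0` this uses the convention `π / 0 = 0`. -/
theorem dvd_of_reflection_mul_reflection_pow_eq_one {V : Type*} [AddCommGroup V] [Module ℝ V]
    {x y : V} {f g : Dual ℝ V} (hf : f x = 2) (hg : g y = 2) {m : ℕ} (hm : m ≠ 1)
    (hy : f y = -2 * Real.cos (Real.pi / m)) (hx : g x = -2 * Real.cos (Real.pi / m))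
    (hxy : LinearIndependent ℝ ![x, y]) {n : ℕ}
    (hn : (reflection hf * reflection hg) ^ n = 1) : m ∣ n := by
  set φ : ℝ := 2 * (Real.pi / m) with hφ
  have ht : 2 * Real.cos φ = f y * g x - 2 := by
    rw [hy, hx, hφ, Real.cos_two_mul]; ring
  have h1 := reflection_mul_reflection_pow_apply_self hf hg n _ ht
  rw [hn, LinearEquiv.coe_one, id_eq] at h1
  obtain ⟨ha, hb⟩ : (S ℝ (n : ℤ)).eval (2 * Real.cos φ) +
      (S ℝ ((n : ℤ) - 1)).eval (2 * Real.cos φ) - 1 = 0 ∧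
      (S ℝ ((n : ℤ) - 1)).eval (2 * Real.cos φ) * -g x = 0 := by
    apply LinearIndependent.pair_iff.1 hxy
    rw [sub_smul, sub_add_eq_add_sub, ← h1]
    simp
  obtain rfl | hm0 := Nat.eq_zero_or_pos m
  · have : φ = 0 := by simp [hφ]
    simp only [this, Real.cos_zero, mul_one, S_eval_two, hx] at hb
    simp at hb
    simp [hb]
  have hm0' : (m : ℝ) ≠ 0 := by positivity
  obtain rfl | hm3 := (show 2 ≤ m by lia).eq_or_lt
  · have : 2 * Real.cos φ = -2 := by simp [hφ, show 2 * (Real.pi / 2) = Real.pi by ring]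
    rw [this, S_eval_neg_two, S_eval_neg_two, Int.negOnePow_sub] at ha
    obtain h | h := Nat.even_or_odd n
    · exact h.two_dvd
    · rw [Int.negOnePow_odd n (by exact_mod_cast h)] at ha
      simp at ha
      norm_num at ha
  have hm3' : (2 : ℝ) < m := by exact_mod_cast hm3
  have hsin : Real.sin φ ≠ 0 := by
    apply ne_of_gt
    apply Real.sin_pos_of_pos_of_lt_pi
    · positivity
    · rw [hφ, ← mul_div_assoc, div_lt_iff₀ (by positivity), mul_comm]
      nlinarith [Real.pi_pos]
  have hgx : -g x ≠ 0 := by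
    have : 0 < Real.cos (Real.pi / m) := by
      apply Real.cos_pos_of_mem_Ioo
      constructor
      · have : 0 < Real.pi / m := by positivity
        linarith [Real.pi_pos]
      · exact div_lt_div_of_pos_left Real.pi_pos (by norm_num) hm3'
    rw [hx]; linarith
  replace hb := (mul_eq_zero.1 hb).resolve_right hgx
  rw [hb, add_zero] at ha
  have h2 := S_two_mul_real_cos φ (n : ℤ)
  have h3 := S_two_mul_real_cos φ ((n : ℤ) - 1)
  rw [hb] at h3
  rw [sub_eq_zero.1 ha] at h2
  push_cast at h2 h3
  simp only [sub_add_cancel, zero_mul, one_mul] at h2 h3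
  rw [add_mul, one_mul, Real.sin_add, ← h3, zero_mul, zero_add] at h2
  have h4 : Real.cos (n * φ) = 1 := by
    apply mul_right_cancel₀ hsin
    rw [← h2, one_mul]
  obtain ⟨k, hk⟩ := (Real.cos_eq_one_iff _).1 h4
  rw [hφ] at hk
  have h5 : (k : ℝ) * m = n := by
    field_simp at hk
    nlinarith [Real.pi_pos]
  have h6 : k * (m : ℤ) = n := by exact_mod_cast h5
  exact Int.natCast_dvd_natCast.1 ⟨k, by rw [← h6, mul_comm]⟩

namespace CoxeterMatrix

variable {B : Type*} (M : CoxeterMatrix B)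

/-- The coroots of the standard geometric representation of a Coxeter matrix. -/
noncomputable def geomCoroot (a : B) : Module.Dual ℝ (B →₀ ℝ) :=
  Finsupp.linearCombination ℝ fun b => -2 * Real.cos (Real.pi / M a b)

theorem geomCoroot_single (a b : B) :
    M.geomCoroot a (Finsupp.single b 1) = -2 * Real.cos (Real.pi / M a b) := by
  simp [geomCoroot]

theorem geomCoroot_single_self (a : B) : M.geomCoroot a (Finsupp.single a 1) = 2 := by
  simp [geomCoroot_single]

/-- The simple reflections of the standard geometric representation of a Coxeter matrix. -/
noncomputable def geomReflection (a : B) : (B →₀ ℝ) ≃ₗ[ℝ] (B →₀ ℝ) :=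
  Module.reflection (M.geomCoroot_single_self a)

theorem isLiftable_geomReflection : M.IsLiftable M.geomReflection := by
  intro a b
  obtain rfl | hab := eq_or_ne a b
  · rw [M.diagonal, pow_one]
    ext1 z
    exact Module.involutive_reflection (M.geomCoroot_single_self a) z
  obtain h0 | h0 := Nat.eq_zero_or_pos (M a b)
  · rw [h0, pow_zero]
  · refine reflection_mul_reflection_pow_eq_one (M.geomCoroot_single_self a)
      (M.geomCoroot_single_self b) ?_ (M.geomCoroot_single a b) ?_
    · have := M.off_diagonal a b hab
      lia
    · rw [geomCoroot_single, M.symmetric]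

end CoxeterMatrix

namespace CoxeterSystem

variable {B W : Type*} [Group W] {M : CoxeterMatrix B} (cs : CoxeterSystem M W)

/-- The order of a product of two simple reflections is the entry of the Coxeter matrix
(`0` meaning infinite order). -/
theorem orderOf_simple_mul_simple (a b : B) : orderOf (cs.simple a * cs.simple b) = M a b := by
  apply Nat.dvd_antisymm (orderOf_dvd_of_pow_eq_one (cs.simple_mul_simple_pow a b))
  obtain rfl | hab := eq_or_ne a b
  · simp
  have h := congrArg (cs.lift ⟨M.geomReflection, M.isLiftable_geomReflection⟩)
    (pow_orderOf_eq_one (cs.simple a * cs.simple b))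
  rw [map_pow, map_mul, lift_apply_simple, lift_apply_simple, map_one] at h
  refine dvd_of_reflection_mul_reflection_pow_eq_one (M.geomCoroot_single_self a)
      (M.geomCoroot_single_self b) (M.off_diagonal a b hab) (M.geomCoroot_single a b) ?_ ?_ h
  · rw [CoxeterMatrix.geomCoroot_single, M.symmetric]
  · rw [LinearIndependent.pair_iff]
    intro s t hst
    have h1 := DFunLike.congr_fun hst a
    have h2 := DFunLike.congr_fun hst b
    simpa [hab, hab.symm] using And.intro h1 h2

theorem simple_injective : Function.Injective cs.simple := by
  intro a b h
  by_contra hab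
  apply M.off_diagonal a b hab
  rw [← cs.orderOf_simple_mul_simple, h, simple_mul_simple_self, orderOf_one]

end CoxeterSystem

/-- The alternating product of length `n` of `a` and `b` that ends with `b`. -/
def altProdEnd {G : Type*} [Monoid G] (a b : G) : ℕ → G
  | 0 => 1
  | n + 1 => (if Even n then b else a) * altProdEnd a b n

section altProdEnd

variable {G H : Type*} [Group G] [Group H]

theorem map_altProdEnd (f : G →* H) (a b : G) (n : ℕ) :
    f (altProdEnd a b n) = altProdEnd (f a) (f b) n := by
  induction n with
  | zero => simp [altProdEnd]
  | succ n ih => simp only [altProdEnd, map_mul, ih]; split_ifs <;> rfl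

theorem altProdEnd_succ (a b : G) (n : ℕ) : altProdEnd a b (n + 1) = altProdEnd b a n * b := by
  induction n with
  | zero => simp [altProdEnd]
  | succ n ih =>
    rw [altProdEnd, ih, altProdEnd, mul_assoc]
    simp only [Nat.even_add_one]
    split_ifs <;> simp_all

variable {a b : G}

theorem altProdEnd_eq_swap_mul (ha : a * a = 1) (hb : b * b = 1) (n : ℕ) :
    altProdEnd a b n = altProdEnd b a n * (a * b) ^ n := by
  induction n generalizing a b with
  | zero => simp [altProdEnd]
  | succ n ih =>
    rw [altProdEnd_succ, ih hb ha, altProdEnd_succ b a, pow_succ', mul_assoc, mul_assoc, mul_assoc,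
      ← mul_assoc a a, ha, one_mul, mul_pow_mul]

theorem altProdEnd_succ' (ha : a * a = 1) (hb : b * b = 1) (n : ℕ) :
    altProdEnd a b (n + 1) = altProdEnd a b n * (b * (a * b) ^ n) := by
  rw [altProdEnd_succ, altProdEnd_eq_swap_mul hb ha, mul_assoc]
  congr 1
  rw [mul_pow_mul]

theorem altProdEnd_swap_iff (ha : a * a = 1) (hb : b * b = 1) (n : ℕ) :
    altProdEnd a b n = altProdEnd b a n ↔ (a * b) ^ n = 1 := by
  rw [altProdEnd_eq_swap_mul ha hb, mul_eq_left]

end altProdEnd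

namespace CoxeterSystem

open Classical in
/-- The sign `-1` if the two elements agree and `1` otherwise. -/
noncomputable def eqSign {W : Type*} (t u : W) : ℤˣ := if t = u then -1 else 1

theorem eqSign_self {W : Type*} (t : W) : eqSign t t = -1 := if_pos rfl

theorem eqSign_eq_neg_one_iff {W : Type*} {t u : W} : eqSign t u = -1 ↔ t = u := by
  unfold eqSign; split_ifs with h <;> simp [h]

variable {B W : Type*} [Group W] {M : CoxeterMatrix B} (cs : CoxeterSystem M W)

theorem eqSign_conj (w t u : W) : eqSign (w * t * w⁻¹) u = eqSign t (w⁻¹ * u * w) := by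
  have : w * t * w⁻¹ = u ↔ t = w⁻¹ * u * w := by
    constructor
    · rintro rfl; group
    · rintro rfl; group
  unfold eqSign
  by_cases h : w * t * w⁻¹ = u
  · rw [if_pos h, if_pos (this.1 h)]
  · rw [if_neg h, if_neg (mt this.2 h)]

/-- The action of a simple reflection on signed elements. -/
noncomputable def signFun (i : B) (p : W × ℤˣ) : W × ℤˣ :=
  (cs.simple i * p.1 * (cs.simple i)⁻¹, p.2 * eqSign p.1 (cs.simple i))

/-- The action of a simple reflection on signed elements, as a permutation. -/
noncomputable def signPerm (i : B) : Equiv.Perm (W × ℤˣ) :=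
  Function.Involutive.toPerm (cs.signFun i) (by
    rintro ⟨t, ε⟩
    ext1
    · simp [signFun, mul_assoc]
    · simp only [signFun, eqSign_conj]
      simp [mul_assoc])

theorem signPerm_apply (i : B) (t : W) (ε : ℤˣ) : cs.signPerm i (t, ε) =
    (cs.simple i * t * (cs.simple i)⁻¹, ε * eqSign t (cs.simple i)) := rfl

theorem altProdEnd_signPerm (a b : B) (n : ℕ) (t : W) (ε : ℤˣ) :
    altProdEnd (cs.signPerm a) (cs.signPerm b) n (t, ε) =
      (altProdEnd (cs.simple a) (cs.simple b) n * t * (altProdEnd (cs.simple a) (cs.simple b) n)⁻¹,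
        ε * ∏ j ∈ Finset.range n,
          eqSign t (cs.simple b * (cs.simple a * cs.simple b) ^ j)) := by
  induction n with
  | zero => simp [altProdEnd]
  | succ n ih =>
    have h := cs.simple_mul_simple_self
    have key : (if Even n then cs.simple b else cs.simple a) =
        altProdEnd (cs.simple a) (cs.simple b) n * (cs.simple b * (cs.simple a * cs.simple b) ^ n)
          * (altProdEnd (cs.simple a) (cs.simple b) n)⁻¹ := by
      rw [eq_mul_inv_iff_mul_eq, ← altProdEnd_succ' (h a) (h b)]
      rfl
    have h2 (c : B) (hc : c = if Even n then b else a) :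
      cs.simple c = (if Even n then cs.simple b else cs.simple a) := by
        rw [hc]; split_ifs <;> rfl
    have h3 : (if Even n then cs.signPerm b else cs.signPerm a) =
        cs.signPerm (if Even n then b else a) := by split_ifs <;> rfl
    rw [altProdEnd, Equiv.Perm.mul_apply, ih, h3, signPerm_apply, h2 _ rfl]
    ext1
    · simp only [altProdEnd, mul_inv_rev, mul_assoc]
    · simp only
      rw [eqSign_conj, Finset.prod_range_succ, mul_assoc]
      congr 3
      rw [key]
      group

theorem simple_mul_pow_reflect (a b : B) {j : ℕ} (hj : j < M a b) :
    cs.simple a * (cs.simple b * cs.simple a) ^ (M a b - 1 - j) =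
      cs.simple b * (cs.simple a * cs.simple b) ^ j := by
  have h := cs.simple_mul_simple_self
  have h1 : (cs.simple a * cs.simple b) ^ (M a b - 1 - j) * (cs.simple a * cs.simple b) ^ (j + 1)
      = 1 := by
    rw [← pow_add, show M a b - 1 - j + (j + 1) = M a b by lia, cs.simple_mul_simple_pow]
  rw [← mul_pow_mul, ← mul_left_inj (cs.simple a), mul_assoc, h a, mul_one,
    eq_inv_of_mul_eq_one_left h1, ← inv_pow, mul_inv_rev, inv_simple, inv_simple, pow_succ,
    ← mul_assoc, ← mul_pow_mul]

theorem isLiftable_signPerm : M.IsLiftable cs.signPerm := by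
  intro a b
  have hinv (i : B) : cs.signPerm i * cs.signPerm i = 1 := by
    ext1 p
    exact (cs.signPerm i).left_inv p
  have h := cs.simple_mul_simple_self
  rw [← altProdEnd_swap_iff (hinv a) (hinv b)]
  ext1 ⟨t, ε⟩
  rw [altProdEnd_signPerm, altProdEnd_signPerm,
    (altProdEnd_swap_iff (h a) (h b) _).2 (cs.simple_mul_simple_pow a b)]
  congr 2
  rw [← Finset.prod_range_reflect, eq_comm]
  refine Finset.prod_congr rfl fun j hj => ?_
  rw [Finset.mem_range] at hj
  rw [← cs.simple_mul_pow_reflect a b (show M a b - 1 - j < M a b by lia)]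
  congr 3
  lia

end CoxeterSystem

namespace CoxeterSystem

variable {B W : Type*} [Group W] {M : CoxeterMatrix B} (cs : CoxeterSystem M W)

/-- The action of a Coxeter group on signed elements; restricted to signed reflections it is
the action on the root system. -/
noncomputable def signAction : W →* Equiv.Perm (W × ℤˣ) :=
  cs.lift ⟨cs.signPerm, cs.isLiftable_signPerm⟩

/-- The sign of `w` at `t`; for a reflection `t` it is `-1` exactly when `t` is a right inversion
of `w`. -/
noncomputable def invSign (w t : W) : ℤˣ := (cs.signAction w (t, 1)).2

theorem signAction_simple (i : B) : cs.signAction (cs.simple i) = cs.signPerm i :=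
  cs.lift_apply_simple _ i

theorem signAction_apply (w t : W) (ε : ℤˣ) :
    cs.signAction w (t, ε) = (w * t * w⁻¹, ε * cs.invSign w t) := by
  suffices h : ∃ η : W → ℤˣ, ∀ t ε, cs.signAction w (t, ε) = (w * t * w⁻¹, ε * η t) by
    obtain ⟨η, h⟩ := h
    rw [invSign, h, h, one_mul]
  induction w using cs.simple_induction_left with
  | one => exact ⟨fun _ => 1, by simp⟩
  | mul_simple_left w i ih =>
    obtain ⟨η, h⟩ := ih
    refine ⟨fun t => η t * eqSign (w * t * w⁻¹) (cs.simple i), fun t ε => ?_⟩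
    rw [map_mul, Equiv.Perm.mul_apply, h, signAction_simple, signPerm_apply]
    simp only [mul_inv_rev, mul_assoc]

theorem invSign_mul (u w t : W) :
    cs.invSign (u * w) t = cs.invSign w t * cs.invSign u (w * t * w⁻¹) := by
  conv_lhs => rw [invSign, map_mul, Equiv.Perm.mul_apply, signAction_apply, signAction_apply]
  simp

theorem invSign_one (t : W) : cs.invSign 1 t = 1 := by
  rw [invSign, map_one]; rfl

theorem invSign_simple (i : B) (t : W) : cs.invSign (cs.simple i) t = eqSign t (cs.simple i) := by
  rw [invSign, signAction_simple, signPerm_apply, one_mul]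

theorem invSign_self {t : W} (ht : cs.IsReflection t) : cs.invSign t t = -1 := by
  obtain ⟨w, i, rfl⟩ := ht
  have h : cs.invSign w⁻¹ (w * cs.simple i * w⁻¹) * cs.invSign w (cs.simple i) = 1 := by
    have := cs.invSign_mul w w⁻¹ (w * cs.simple i * w⁻¹)
    rw [mul_inv_cancel, invSign_one] at this
    rw [this]
    congr 2
    group
  rw [invSign_mul, show w⁻¹ * (w * cs.simple i * w⁻¹) * w⁻¹⁻¹ = cs.simple i by group, invSign_mul,
    invSign_simple, eqSign_self, show cs.simple i * cs.simple i * (cs.simple i)⁻¹ = cs.simple i by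
      group, neg_one_mul, mul_neg, h]

theorem mem_rightInvSeq_of_invSign {ω : List B} {t : W}
    (h : cs.invSign (cs.wordProd ω) t = -1) : t ∈ cs.rightInvSeq ω := by
  induction ω with
  | nil => simp [invSign_one] at h
  | cons i ω ih =>
    rw [wordProd_cons, invSign_mul, invSign_simple] at h
    rw [rightInvSeq, List.mem_cons]
    obtain h1 | h1 := Int.units_eq_one_or (cs.invSign (cs.wordProd ω) t)
    · left
      rw [h1, one_mul, eqSign_eq_neg_one_iff] at h
      rw [← h]
      group
    · exact Or.inr (ih h1)

theorem length_mul_lt_of_invSign {w t : W} (h : cs.invSign w t = -1) :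
    cs.length (w * t) < cs.length w := by
  obtain ⟨ω, hω, rfl⟩ := cs.exists_isReduced w
  exact (cs.isRightInversion_of_mem_rightInvSeq hω (cs.mem_rightInvSeq_of_invSign h)).2

theorem invSign_eq_neg_one_iff {w t : W} (ht : cs.IsReflection t) :
    cs.invSign w t = -1 ↔ cs.length (w * t) < cs.length w := by
  refine ⟨cs.length_mul_lt_of_invSign, fun h => ?_⟩
  obtain h1 | h1 := Int.units_eq_one_or (cs.invSign w t)
  · have := cs.invSign_mul w t t
    rw [invSign_self cs ht, mul_inv_cancel_right, h1, mul_one] at this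
    have := cs.length_mul_lt_of_invSign this
    rw [mul_assoc, ht.mul_self, mul_one] at this
    lia
  · exact h1

theorem invSign_eq_one_iff {w t : W} (ht : cs.IsReflection t) :
    cs.invSign w t = 1 ↔ cs.length w ≤ cs.length (w * t) := by
  rw [← not_lt, ← cs.invSign_eq_neg_one_iff ht]
  obtain h | h := Int.units_eq_one_or (cs.invSign w t) <;> simp [h]

theorem exists_eraseIdx_of_invSign {ω : List B} {t : W}
    (h : cs.invSign (cs.wordProd ω) t = -1) :
    ∃ j < ω.length, cs.wordProd ω * t = cs.wordProd (ω.eraseIdx j) := by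
  obtain ⟨j, hj, rfl⟩ := List.getElem_of_mem (cs.mem_rightInvSeq_of_invSign h)
  refine ⟨j, by simpa using hj, ?_⟩
  rw [← cs.wordProd_mul_getD_rightInvSeq, List.getD_eq_getElem _ _ hj]

/-- The sign of an alternating product. -/
theorem invSign_altProdEnd (a b : B) (n : ℕ) (t : W) :
    cs.invSign (altProdEnd (cs.simple a) (cs.simple b) n) t =
      ∏ j ∈ Finset.range n, eqSign t (cs.simple b * (cs.simple a * cs.simple b) ^ j) := by
  rw [invSign, map_altProdEnd, signAction_simple, signAction_simple, altProdEnd_signPerm, one_mul]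

/-! ### Standard parabolic subgroups -/

/-- The standard parabolic subgroup of a Coxeter group generated by a set of simple
reflections. -/
def standardParabolic (X : Set B) : Subgroup W := Subgroup.closure (cs.simple '' X)

variable {X Y : Set B}

theorem simple_mem_standardParabolic {i : B} (hi : i ∈ X) :
    cs.simple i ∈ cs.standardParabolic X :=
  Subgroup.subset_closure ⟨i, hi, rfl⟩

theorem wordProd_mem_standardParabolic {ω : List B} (hω : ∀ i ∈ ω, i ∈ X) :
    cs.wordProd ω ∈ cs.standardParabolic X := by
  induction ω with
  | nil => simp [one_mem]
  | cons i ω ih =>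
    rw [wordProd_cons]
    exact mul_mem (cs.simple_mem_standardParabolic (hω i (by simp)))
      (ih fun j hj => hω j (by simp [hj]))

theorem standardParabolic_mono (h : X ⊆ Y) :
    cs.standardParabolic X ≤ cs.standardParabolic Y :=
  Subgroup.closure_mono (Set.image_mono h)

/-- An element of a standard parabolic subgroup has a reduced word in the given letters. -/
theorem exists_isReduced_of_mem_standardParabolic {w : W} (hw : w ∈ cs.standardParabolic X) :
    ∃ ω : List B, cs.IsReduced ω ∧ w = cs.wordProd ω ∧ ∀ i ∈ ω, i ∈ X := by
  have step (w : W) (i : B) (hi : i ∈ X)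
      (h : ∃ ω : List B, cs.IsReduced ω ∧ w = cs.wordProd ω ∧ ∀ i ∈ ω, i ∈ X) :
      ∃ ω : List B, cs.IsReduced ω ∧ w * cs.simple i = cs.wordProd ω ∧ ∀ i ∈ ω, i ∈ X := by
    obtain ⟨ω, hω, rfl, hX⟩ := h
    by_cases hd : cs.IsRightDescent (cs.wordProd ω) i
    · obtain ⟨j, hj, h⟩ := cs.exists_eraseIdx_of_invSign
        ((cs.invSign_eq_neg_one_iff (cs.isReflection_simple i)).2 hd)
      refine ⟨ω.eraseIdx j, ?_, h, fun i hi => hX i (List.mem_of_mem_eraseIdx hi)⟩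
      have h1 := cs.isRightDescent_iff.1 hd
      have h2 := List.length_eraseIdx_add_one hj
      rw [IsReduced, ← h]
      rw [hω.eq] at h1
      lia
    · refine ⟨ω.concat i, ?_, (cs.wordProd_concat i ω).symm, ?_⟩
      · rw [IsReduced, wordProd_concat, cs.not_isRightDescent_iff.1 hd, hω.eq]
        simp
      · intro k hk
        rw [List.concat_eq_append, List.mem_append, List.mem_singleton] at hk
        obtain hk | rfl := hk
        exacts [hX k hk, hi]
  induction hw using Subgroup.closure_induction_right with
  | one => exact ⟨[], by simp [IsReduced], by simp, by simp⟩
  | mul_right w hw y hy ih =>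
    obtain ⟨i, hi, rfl⟩ := hy
    exact step w i hi ih
  | mul_inv_cancel w hw y hy ih =>
    obtain ⟨i, hi, rfl⟩ := hy
    rw [inv_simple]
    exact step w i hi ih

theorem exists_rightDescent_of_mem_standardParabolic {w : W} (hw : w ∈ cs.standardParabolic X)
    (h1 : w ≠ 1) : ∃ i ∈ X, cs.invSign w (cs.simple i) = -1 := by
  obtain ⟨ω, hω, rfl, hX⟩ := cs.exists_isReduced_of_mem_standardParabolic hw
  obtain rfl | ⟨ω, i, rfl⟩ := List.eq_nil_or_concat' ω
  · simp at h1
  · refine ⟨i, hX i (by simp), ?_⟩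
    rw [cs.invSign_eq_neg_one_iff (cs.isReflection_simple i), hω.eq, wordProd_append,
      wordProd_singleton, simple_mul_simple_cancel_right]
    have := cs.length_wordProd_le ω
    simp
    lia

theorem simple_mem_standardParabolic_iff {i : B} : cs.simple i ∈ cs.standardParabolic X ↔ i ∈ X := by
  refine ⟨fun h => ?_, cs.simple_mem_standardParabolic⟩
  obtain ⟨ω, hω, h, hX⟩ := cs.exists_isReduced_of_mem_standardParabolic h
  have h1 := hω.eq
  rw [← h, length_simple] at h1
  obtain ⟨j, rfl⟩ := List.length_eq_one_iff.1 h1.symm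
  rw [wordProd_singleton] at h
  rw [cs.simple_injective h]
  exact hX j (by simp)

/-- A reflection in a standard parabolic subgroup is a reflection of that subgroup. -/
theorem exists_conj_of_mem_standardParabolic {t : W} (ht : cs.IsReflection t)
    (h : t ∈ cs.standardParabolic X) :
    ∃ w ∈ cs.standardParabolic X, ∃ i ∈ X, t = w * cs.simple i * w⁻¹ := by
  obtain ⟨ω, -, hω, hX⟩ := cs.exists_isReduced_of_mem_standardParabolic h
  have hs := cs.invSign_self ht
  nth_rw 1 [hω] at hs
  replace hs := cs.mem_rightInvSeq_of_invSign hs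
  clear hω
  induction ω with
  | nil => simp at hs
  | cons i ω ih =>
    rw [rightInvSeq, List.mem_cons] at hs
    have hX' : ∀ j ∈ ω, j ∈ X := fun j hj => hX j (by simp [hj])
    obtain h1 | h1 := hs
    · refine ⟨(cs.wordProd ω)⁻¹, inv_mem (cs.wordProd_mem_standardParabolic hX'), i,
        hX i (by simp), ?_⟩
      rw [h1, inv_inv]
    · exact ih hX' h1

theorem standardParabolic_inf (X Y : Set B) :
    cs.standardParabolic X ⊓ cs.standardParabolic Y = cs.standardParabolic (X ∩ Y) := by
  apply le_antisymm
  · rintro w ⟨hX, hY⟩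
    induction hn : cs.length w using Nat.strong_induction_on generalizing w with
    | _ n ih =>
    by_cases h1 : w = 1
    · rw [h1]; exact one_mem _
    obtain ⟨i, hi, hd⟩ := cs.exists_rightDescent_of_mem_standardParabolic hX h1
    have hiX := cs.simple_mem_standardParabolic hi
    have hiY : cs.simple i ∈ cs.standardParabolic Y := by
      obtain ⟨ω, -, rfl, hω⟩ := cs.exists_isReduced_of_mem_standardParabolic hY
      obtain ⟨j, -, h⟩ := cs.exists_eraseIdx_of_invSign hd
      rw [← eq_inv_mul_iff_mul_eq] at h
      rw [h]
      exact mul_mem (inv_mem hY) (cs.wordProd_mem_standardParabolic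
        fun k hk => hω k (List.mem_of_mem_eraseIdx hk))
    have := ih _ (hn ▸ cs.length_mul_lt_of_invSign hd) (mul_mem hX hiX) (mul_mem hY hiY) rfl
    rw [← cs.simple_mul_simple_cancel_right (w := w) i]
    exact mul_mem this (cs.simple_mem_standardParabolic
      ⟨hi, cs.simple_mem_standardParabolic_iff.1 hiY⟩)
  · exact le_inf (cs.standardParabolic_mono Set.inter_subset_left)
      (cs.standardParabolic_mono Set.inter_subset_right)

/-! ### Minimal coset representatives -/

/-- If `u` is minimal in its coset `u * W_J`, then a simple reflection of the form `u * r * u⁻¹`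
with `r` in `W_J` only arises from a simple reflection `r`. -/
theorem eq_simple_of_conj_eq_simple {J : Set B} {u r : W}
    (hu : ∀ t ∈ cs.standardParabolic J, cs.IsReflection t → cs.invSign u t = 1)
    (hr : r ∈ cs.standardParabolic J) {x : B} (hx : u * r * u⁻¹ = cs.simple x) :
    ∃ c ∈ J, r = cs.simple c := by
  have hr1 : r ≠ 1 := by
    rintro rfl
    rw [mul_one, mul_inv_cancel] at hx
    have := cs.length_simple x
    rw [← hx, length_one] at this
    lia
  obtain ⟨c, hc, hd⟩ := cs.exists_rightDescent_of_mem_standardParabolic hr hr1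
  have hcJ := cs.simple_mem_standardParabolic hc
  refine ⟨c, hc, ?_⟩
  have h1 := cs.invSign_mul u r (cs.simple c)
  rw [hd, hu _ (mul_mem (mul_mem hr hcJ) (inv_mem hr)) ((cs.isReflection_simple c).conj r),
    ← inv_mul_cancel_right (u * r) u, hx, invSign_mul, hu _ hcJ (cs.isReflection_simple c),
    invSign_simple, one_mul, mul_one, eqSign_eq_neg_one_iff, ← hx] at h1
  exact (mul_left_cancel (mul_right_cancel h1)).symm

/-- Every element is a product of a minimal left coset representative and an element of the
standard parabolic subgroup. -/
theorem exists_min_mul (J : Set B) (w : W) : ∃ u, ∃ p ∈ cs.standardParabolic J, w = u * p ∧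
    (∀ t ∈ cs.standardParabolic J, cs.IsReflection t → cs.invSign u t = 1) ∧
    ∀ q ∈ cs.standardParabolic J, cs.length u ≤ cs.length (w * q) := by
  obtain ⟨q, hq, hmin⟩ := WellFounded.has_min
    (InvImage.wf (fun q : W => cs.length (w * q)) (Nat.lt_wfRel.wf))
    (cs.standardParabolic J : Set W) ⟨1, one_mem _⟩
  have hmin' : ∀ r ∈ cs.standardParabolic J, cs.length (w * q) ≤ cs.length (w * r) :=
    fun r hr => not_lt.1 (hmin r hr)
  refine ⟨w * q, q⁻¹, inv_mem hq, by group, fun t ht htr => ?_, hmin'⟩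
  rw [cs.invSign_eq_one_iff htr, mul_assoc]
  exact hmin' _ (mul_mem hq ht)

end CoxeterSystem

/-- The braid relations of a Coxeter matrix. -/
def artinRels {B : Type*} (M : CoxeterMatrix B) : Set (FreeGroup B) :=
  {r | ∃ a b : B, a ≠ b ∧ M a b ≠ 0 ∧
    r = altProdEnd (FreeGroup.of a) (FreeGroup.of b) (M a b) *
      (altProdEnd (FreeGroup.of b) (FreeGroup.of a) (M a b))⁻¹}

/-- The Artin group of a Coxeter matrix. -/
abbrev ArtinGroup {B : Type*} (M : CoxeterMatrix B) : Type _ := PresentedGroup (artinRels M)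

namespace ArtinGroup

variable {B : Type*} {M : CoxeterMatrix B}

/-- The standard generators of an Artin group. -/
def gen (M : CoxeterMatrix B) (b : B) : ArtinGroup M := PresentedGroup.of b

theorem braid {a b : B} (h : a ≠ b) (h0 : M a b ≠ 0) :
    altProdEnd (gen M a) (gen M b) (M a b) = altProdEnd (gen M b) (gen M a) (M a b) := by
  rw [← mul_inv_eq_one]
  have := PresentedGroup.one_of_mem (rels := artinRels M) ⟨a, b, h, h0, rfl⟩
  rwa [map_mul, map_inv, map_altProdEnd, map_altProdEnd] at this

/-- The homomorphism out of an Artin group given by elements satisfying the braid relations. -/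
def lift {G : Type*} [Group G] (f : B → G) (hf : ∀ a b, a ≠ b → M a b ≠ 0 →
    altProdEnd (f a) (f b) (M a b) = altProdEnd (f b) (f a) (M a b)) : ArtinGroup M →* G :=
  PresentedGroup.toGroup (f := f) (by
    rintro r ⟨a, b, h, h0, rfl⟩
    rw [map_mul, map_inv, map_altProdEnd, map_altProdEnd, FreeGroup.lift_apply_of,
      FreeGroup.lift_apply_of, hf a b h h0, mul_inv_cancel])

theorem lift_gen {G : Type*} [Group G] (f : B → G) (hf) (b : B) :
    lift (M := M) f hf (gen M b) = f b := PresentedGroup.toGroup.of _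

theorem hom_ext {G : Type*} [Group G] {f g : ArtinGroup M →* G}
    (h : ∀ b, f (gen M b) = g (gen M b)) : f = g :=
  PresentedGroup.ext h

variable {W : Type*} [Group W] (cs : CoxeterSystem M W) (X : Set B)

/-- The elements without right descents in `X`. -/
abbrev MinReps : Type _ := {w : W // ∀ x ∈ X, cs.invSign w (cs.simple x) = 1}

open Classical in
/-- A generator acts on a minimal coset representative by left multiplication if this gives
another representative, and on the second coordinate otherwise. -/
noncomputable def stepFun (f : B → ArtinGroup M) (c : B) (p : MinReps cs X × ArtinGroup M) :
    MinReps cs X × ArtinGroup M :=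
  if h : ∃ x ∈ X, (p.1 : W)⁻¹ * cs.simple c * p.1 = cs.simple x then (p.1, f h.choose * p.2)
  else (⟨cs.simple c * p.1, fun x hx => by
    rw [cs.invSign_mul, p.1.2 x hx, cs.invSign_simple, one_mul]
    refine (Int.units_eq_one_or _).resolve_right fun h1 => h ⟨x, hx, ?_⟩
    rw [← CoxeterSystem.eqSign_eq_neg_one_iff.1 h1]
    group⟩, p.2)

variable {X}

theorem stepFun_of_label (f : B → ArtinGroup M) {c x : B} (w : MinReps cs X) (g : ArtinGroup M)
    (hx : x ∈ X) (h : (w : W)⁻¹ * cs.simple c * w = cs.simple x) :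
    stepFun cs X f c (w, g) = (w, f x * g) := by
  have h' : ∃ x ∈ X, (w : W)⁻¹ * cs.simple c * w = cs.simple x := ⟨x, hx, h⟩
  rw [stepFun, dif_pos h']
  rw [cs.simple_injective (h.symm.trans h'.choose_spec.2)]

theorem stepFun_of_not_label (f : B → ArtinGroup M) {c : B} (w : MinReps cs X) (g : ArtinGroup M)
    (h : ¬ ∃ x ∈ X, (w : W)⁻¹ * cs.simple c * w = cs.simple x) :
    ((stepFun cs X f c (w, g)).1 : W) = cs.simple c * w ∧ (stepFun cs X f c (w, g)).2 = g := by
  rw [stepFun, dif_neg h]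
  exact ⟨rfl, rfl⟩

theorem stepFun_stepFun {f f' : B → ArtinGroup M} (hf : ∀ x, f x * f' x = 1) (c : B)
    (p : MinReps cs X × ArtinGroup M) : stepFun cs X f c (stepFun cs X f' c p) = p := by
  obtain ⟨w, g⟩ := p
  by_cases h : ∃ x ∈ X, (w : W)⁻¹ * cs.simple c * w = cs.simple x
  · obtain ⟨x, hx, h⟩ := h
    rw [stepFun_of_label cs f' w g hx h, stepFun_of_label cs f w _ hx h, ← mul_assoc, hf, one_mul]
  · obtain ⟨h1, h2⟩ := stepFun_of_not_label cs f' w g h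
    obtain ⟨v, hv⟩ : ∃ v, v = stepFun cs X f' c (w, g) := ⟨_, rfl⟩
    rw [← hv] at h1 h2 ⊢
    obtain ⟨v, g'⟩ := v
    dsimp only at h1 h2
    subst h2
    obtain ⟨h3, h4⟩ := stepFun_of_not_label (c := c) cs f v g' (by
      simpa only [h1, mul_inv_rev, mul_assoc, cs.inv_simple, cs.simple_mul_simple_cancel_left]
        using h)
    ext1
    · ext1
      exact h3.trans (by rw [h1, cs.simple_mul_simple_cancel_left])
    · exact h4

/-- The action of a generator on pairs, as a permutation. -/
noncomputable def stepPerm (X : Set B) (c : B) : Equiv.Perm (MinReps cs X × ArtinGroup M) where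
  toFun := stepFun cs X (gen M) c
  invFun := stepFun cs X (fun x => (gen M x)⁻¹) c
  left_inv := stepFun_stepFun cs (fun _ => inv_mul_cancel _) c
  right_inv := stepFun_stepFun cs (fun _ => mul_inv_cancel _) c

theorem stepPerm_of_label {c x : B} (w : MinReps cs X) (g : ArtinGroup M)
    (hx : x ∈ X) (h : (w : W)⁻¹ * cs.simple c * w = cs.simple x) :
    stepPerm cs X c (w, g) = (w, gen M x * g) :=
  stepFun_of_label cs _ w g hx h

theorem stepPerm_of_not_label {c : B} (w : MinReps cs X) (g : ArtinGroup M)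
    (h : ¬ ∃ x ∈ X, (w : W)⁻¹ * cs.simple c * w = cs.simple x) :
    ((stepPerm cs X c (w, g)).1 : W) = cs.simple c * w ∧ (stepPerm cs X c (w, g)).2 = g :=
  stepFun_of_not_label cs _ w g h

theorem altProdEnd_stepPerm_of_labels {a b x y : B} (w : MinReps cs X) (g : ArtinGroup M)
    (hx : x ∈ X) (ha : (w : W)⁻¹ * cs.simple a * w = cs.simple x)
    (hy : y ∈ X) (hb : (w : W)⁻¹ * cs.simple b * w = cs.simple y) (n : ℕ) :
    altProdEnd (stepPerm cs X a) (stepPerm cs X b) n (w, g) =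
      (w, altProdEnd (gen M x) (gen M y) n * g) := by
  induction n with
  | zero => simp [altProdEnd]
  | succ n ih =>
    rw [altProdEnd, Equiv.Perm.mul_apply, ih, altProdEnd]
    split_ifs
    · rw [stepPerm_of_label cs w _ hy hb, mul_assoc]
    · rw [stepPerm_of_label cs w _ hx ha, mul_assoc]

open Classical in
theorem altProdEnd_stepPerm_of_unique_label {a b x : B} (w : MinReps cs X) (g : ArtinGroup M)
    (H : ∀ p ∈ cs.standardParabolic {a, b}, ∀ c ∈ ({a, b} : Set B), ∀ y ∈ X,
      (p * w : W)⁻¹ * cs.simple c * (p * w) = cs.simple y → y = x) (n : ℕ) :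
    (∃ p ∈ cs.standardParabolic {a, b},
      ((altProdEnd (stepPerm cs X a) (stepPerm cs X b) n (w, g)).1 : W) = p * w) ∧
    ((altProdEnd (stepPerm cs X a) (stepPerm cs X b) n (w, g)).1 : W) =
      altProdEnd (cs.simple a) (cs.simple b) n * w * cs.simple x ^ (∑ j ∈ Finset.range n,
        if x ∈ X ∧ (w : W)⁻¹ * (cs.simple b * (cs.simple a * cs.simple b) ^ j) * w = cs.simple x
        then 1 else 0) ∧
    (altProdEnd (stepPerm cs X a) (stepPerm cs X b) n (w, g)).2 =
      gen M x ^ (∑ j ∈ Finset.range n,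
        if x ∈ X ∧ (w : W)⁻¹ * (cs.simple b * (cs.simple a * cs.simple b) ^ j) * w = cs.simple x
        then 1 else 0) * g := by
  induction n with
  | zero => exact ⟨⟨1, one_mem _, by simp [altProdEnd]⟩, by simp [altProdEnd], by simp [altProdEnd]⟩
  | succ n ih =>
    obtain ⟨⟨p, hp, h1⟩, h2, h3⟩ := ih
    rw [Finset.sum_range_succ, altProdEnd, Equiv.Perm.mul_apply]
    generalize (∑ j ∈ Finset.range n, if x ∈ X ∧ (w : W)⁻¹ * (cs.simple b *
      (cs.simple a * cs.simple b) ^ j) * w = cs.simple x then 1 else 0) = k at *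
    obtain ⟨⟨v, g'⟩, hv⟩ : ∃ v, v = altProdEnd (stepPerm cs X a) (stepPerm cs X b) n (w, g) :=
      ⟨_, rfl⟩
    rw [← hv] at h1 h2 h3 ⊢
    dsimp only at h1 h2 h3
    obtain ⟨c, hc, hce⟩ : ∃ c, c ∈ ({a, b} : Set B) ∧ c = if Even n then b else a :=
      ⟨_, by split_ifs <;> simp, rfl⟩
    have hcs : (if Even n then stepPerm cs X b else stepPerm cs X a) = stepPerm cs X c := by
      rw [hce]; split_ifs <;> rfl
    have hcE : altProdEnd (cs.simple a) (cs.simple b) (n + 1) =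
        cs.simple c * altProdEnd (cs.simple a) (cs.simple b) n := by
      rw [hce, altProdEnd]; split_ifs <;> rfl
    have hcE' := altProdEnd_succ' (cs.simple_mul_simple_self a) (cs.simple_mul_simple_self b) n
    have key : (v : W)⁻¹ * cs.simple c * v = cs.simple x ↔
        (w : W)⁻¹ * (cs.simple b * (cs.simple a * cs.simple b) ^ n) * w = cs.simple x := by
      have e1 : cs.simple c = altProdEnd (cs.simple a) (cs.simple b) n *
          (cs.simple b * (cs.simple a * cs.simple b) ^ n) *
          (altProdEnd (cs.simple a) (cs.simple b) n)⁻¹ := by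
        rw [← hcE', hcE, mul_inv_cancel_right]
      have e2 : (v : W)⁻¹ * cs.simple c * v = (cs.simple x ^ k)⁻¹ *
          ((w : W)⁻¹ * (cs.simple b * (cs.simple a * cs.simple b) ^ n) * w) * cs.simple x ^ k := by
        rw [h2, e1]; group
      rw [e2]
      constructor
      · intro h
        rw [mul_assoc, inv_mul_eq_iff_eq_mul, ← pow_succ, pow_succ'] at h
        exact mul_right_cancel h
      · intro h
        rw [h, mul_assoc, ← pow_succ', pow_succ, inv_mul_cancel_left]
    rw [hcs]
    by_cases hl : ∃ y ∈ X, (v : W)⁻¹ * cs.simple c * v = cs.simple y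
    · obtain ⟨y, hy, hl⟩ := hl
      obtain rfl := H p hp c hc y hy (by rw [← h1]; exact hl)
      rw [stepPerm_of_label cs v g' hy hl, if_pos ⟨hy, key.1 hl⟩]
      refine ⟨⟨p, hp, h1⟩, ?_, ?_⟩
      · dsimp only
        have e := key.1 hl
        rw [mul_assoc, inv_mul_eq_iff_eq_mul] at e
        rw [hcE', mul_assoc _ _ (w : W), e, h2, pow_succ', mul_assoc, mul_assoc, mul_assoc,
          cs.simple_mul_simple_cancel_left]
      · rw [h3, pow_succ', mul_assoc]
    · obtain ⟨h4, h5⟩ := stepPerm_of_not_label cs v g' hl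
      rw [if_neg (fun h => hl ⟨x, h.1, key.2 h.2⟩), add_zero, h4, h5]
      refine ⟨⟨cs.simple c * p, mul_mem (cs.simple_mem_standardParabolic hc) hp, ?_⟩, ?_, h3⟩
      · rw [h1, mul_assoc]
      · rw [h2, hcE]; simp only [mul_assoc]

theorem stepPerm_braid {a b : B} (hab : a ≠ b) (h0 : M a b ≠ 0) :
    altProdEnd (stepPerm cs X a) (stepPerm cs X b) (M a b) =
      altProdEnd (stepPerm cs X b) (stepPerm cs X a) (M a b) := by
  classical
  ext1 ⟨w, g⟩
  obtain ⟨u, q, hq, hw, hu, -⟩ := cs.exists_min_mul {a, b} (w : W)⁻¹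
  have haJ : a ∈ ({a, b} : Set B) := by simp
  have hbJ : b ∈ ({a, b} : Set B) := by simp
  by_cases hboth : (∃ x ∈ X, u * cs.simple a * u⁻¹ = cs.simple x) ∧
      (∃ y ∈ X, u * cs.simple b * u⁻¹ = cs.simple y)
  · obtain ⟨⟨x, hx, hxa⟩, ⟨y, hy, hyb⟩⟩ := hboth
    have hq1 : q = 1 := by
      by_contra hq1
      obtain ⟨c, hc, hd⟩ := cs.exists_rightDescent_of_mem_standardParabolic (inv_mem hq)
        (inv_ne_one.2 hq1)
      obtain ⟨z, hz, hzc⟩ : ∃ z ∈ X, u * cs.simple c * u⁻¹ = cs.simple z := by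
        obtain rfl | rfl := hc
        exacts [⟨x, hx, hxa⟩, ⟨y, hy, hyb⟩]
      have h1 := w.2 z hz
      have h2 := cs.invSign_mul u⁻¹ u (cs.simple c)
      rw [inv_mul_cancel, cs.invSign_one, hzc, hu _ (cs.simple_mem_standardParabolic hc)
        (cs.isReflection_simple c), one_mul] at h2
      rw [show (w : W) = q⁻¹ * u⁻¹ by rw [← mul_inv_rev, ← hw, inv_inv], cs.invSign_mul, ← h2,
        one_mul, show u⁻¹ * cs.simple z * u⁻¹⁻¹ = cs.simple c by rw [← hzc]; group, hd] at h1
      exact absurd h1 (by decide)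
    rw [hq1, mul_one] at hw
    have ha : (w : W)⁻¹ * cs.simple a * w = cs.simple x := by
      rw [hw, ← hxa, ← hw, inv_inv]
    have hb : (w : W)⁻¹ * cs.simple b * w = cs.simple y := by
      rw [hw, ← hyb, ← hw, inv_inv]
    have hxy : x ≠ y := by
      rintro rfl
      rw [← hb] at ha
      exact hab (cs.simple_injective (mul_left_cancel (mul_right_cancel ha)))
    have hM : M x y = M a b := by
      rw [← cs.orderOf_simple_mul_simple, ← cs.orderOf_simple_mul_simple, ← ha, ← hb]
      have : (w : W)⁻¹ * cs.simple a * w * ((w : W)⁻¹ * cs.simple b * w) =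
          MulAut.conj (w : W)⁻¹ (cs.simple a * cs.simple b) := by
        rw [MulAut.conj_apply]; group
      rw [this, MulEquiv.orderOf_eq]
    rw [altProdEnd_stepPerm_of_labels cs w g hx ha hy hb,
      altProdEnd_stepPerm_of_labels cs w g hy hb hx ha, ← hM, braid hxy (hM ▸ h0)]
  · have hlab : ∀ p ∈ cs.standardParabolic {a, b}, ∀ c ∈ ({a, b} : Set B), ∀ y ∈ X,
        (p * w : W)⁻¹ * cs.simple c * (p * w) = cs.simple y →
          u * cs.simple a * u⁻¹ = cs.simple y ∨ u * cs.simple b * u⁻¹ = cs.simple y := by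
      intro p hp c hc y hy h
      have e : (p * w : W)⁻¹ * cs.simple c * (p * w) =
          u * ((q * p⁻¹) * cs.simple c * (q * p⁻¹)⁻¹) * u⁻¹ := by
        rw [← inv_inv (w : W), hw]; group
      have hqp := mul_mem hq (inv_mem hp)
      obtain ⟨d, hd, hdr⟩ := cs.eq_simple_of_conj_eq_simple hu
        (mul_mem (mul_mem hqp (cs.simple_mem_standardParabolic hc)) (inv_mem hqp)) (e.symm.trans h)
      rw [e, hdr] at h
      obtain rfl | rfl := hd
      exacts [Or.inl h, Or.inr h]
    obtain ⟨x, hx⟩ : ∃ x, ∀ y ∈ X, (u * cs.simple a * u⁻¹ = cs.simple y ∨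
        u * cs.simple b * u⁻¹ = cs.simple y) → y = x := by
      by_cases h1 : ∃ x ∈ X, u * cs.simple a * u⁻¹ = cs.simple x
      · obtain ⟨x, hx, hxa⟩ := h1
        refine ⟨x, fun y hy h => ?_⟩
        obtain h | h := h
        · exact cs.simple_injective (h.symm.trans hxa)
        · exact absurd ⟨⟨x, hx, hxa⟩, ⟨y, hy, h⟩⟩ hboth
      · by_cases h2 : ∃ x ∈ X, u * cs.simple b * u⁻¹ = cs.simple x
        · obtain ⟨x, hx, hxb⟩ := h2
          refine ⟨x, fun y hy h => ?_⟩
          obtain h | h := h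
          · exact absurd ⟨y, hy, h⟩ h1
          · exact cs.simple_injective (h.symm.trans hxb)
        · exact ⟨a, fun y hy h => h.elim (fun h => absurd ⟨y, hy, h⟩ h1)
            (fun h => absurd ⟨y, hy, h⟩ h2)⟩
    have H : ∀ p ∈ cs.standardParabolic {a, b}, ∀ c ∈ ({a, b} : Set B), ∀ y ∈ X,
        (p * w : W)⁻¹ * cs.simple c * (p * w) = cs.simple y → y = x :=
      fun p hp c hc y hy h => hx y hy (hlab p hp c hc y hy h)
    obtain ⟨-, h1, h2⟩ := altProdEnd_stepPerm_of_unique_label cs w g H (M a b)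
    obtain ⟨-, h3, h4⟩ := altProdEnd_stepPerm_of_unique_label (a := b) (b := a) cs w g
      (by rw [Set.pair_comm]; exact H) (M a b)
    have hsum : (∑ j ∈ Finset.range (M a b),
        if x ∈ X ∧ (w : W)⁻¹ * (cs.simple a * (cs.simple b * cs.simple a) ^ j) * w = cs.simple x
        then 1 else 0) = ∑ j ∈ Finset.range (M a b),
        if x ∈ X ∧ (w : W)⁻¹ * (cs.simple b * (cs.simple a * cs.simple b) ^ j) * w = cs.simple x
        then 1 else 0 := by
      rw [← Finset.sum_range_reflect]
      refine Finset.sum_congr rfl fun j hj => ?_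
      rw [cs.simple_mul_pow_reflect a b (Finset.mem_range.1 hj)]
    have hE := (altProdEnd_swap_iff (cs.simple_mul_simple_self a) (cs.simple_mul_simple_self b)
      (M a b)).2 (cs.simple_mul_simple_pow a b)
    ext1
    · ext1
      rw [h1, h3, hsum, hE]
    · rw [h2, h4, hsum]

/-- The action of an Artin group on pairs of a minimal coset representative of a standard
parabolic subgroup of the Coxeter group and an element of the Artin group. -/
noncomputable def stepAction (X : Set B) :
    ArtinGroup M →* Equiv.Perm (MinReps cs X × ArtinGroup M) :=
  lift (stepPerm cs X) fun _ _ hab h0 => stepPerm_braid cs hab h0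

/-- The standard parabolic subgroup of an Artin group generated by a set of generators. -/
def parabolic (M : CoxeterMatrix B) (X : Set B) : Subgroup (ArtinGroup M) :=
  Subgroup.closure (gen M '' X)

theorem gen_mem_parabolic {x : B} (hx : x ∈ X) : gen M x ∈ parabolic M X :=
  Subgroup.subset_closure ⟨x, hx, rfl⟩

include cs in
theorem parabolic_inf_le (X Y : Set B) :
    parabolic M X ⊓ parabolic M Y ≤ parabolic M (X ∩ Y) := by
  rintro g ⟨hX, hY⟩
  have h1 : ∀ h, stepAction cs X g (⟨1, fun x _ => cs.invSign_one _⟩, h) =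
      (⟨1, fun x _ => cs.invSign_one _⟩, g * h) := by
    clear hY
    induction hX using Subgroup.closure_induction with
    | mem g hg =>
      obtain ⟨x, hx, rfl⟩ := hg
      intro h
      rw [stepAction, lift_gen]
      exact stepPerm_of_label cs _ h hx (by simp)
    | one => simp
    | mul g g' _ _ ih ih' =>
      intro h
      rw [map_mul, Equiv.Perm.mul_apply, ih', ih, mul_assoc]
    | inv g _ ih =>
      intro h
      rw [map_inv, Equiv.Perm.inv_eq_iff_eq, ih, mul_inv_cancel_left]
  have h2 : ∀ p, (((stepAction cs X g p).1 : W) ∈ cs.standardParabolic Y ∧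
      (stepAction cs X g p).2 ∈ parabolic M (X ∩ Y)) ↔
      ((p.1 : W) ∈ cs.standardParabolic Y ∧ p.2 ∈ parabolic M (X ∩ Y)) := by
    clear hX h1
    induction hY using Subgroup.closure_induction with
    | mem g hg =>
      obtain ⟨y, hy, rfl⟩ := hg
      rintro ⟨w, h⟩
      rw [stepAction, lift_gen]
      have hyY := cs.simple_mem_standardParabolic hy
      by_cases hl : ∃ x ∈ X, (w : W)⁻¹ * cs.simple y * w = cs.simple x
      · obtain ⟨x, hx, hl⟩ := hl
        rw [stepPerm_of_label cs w h hx hl]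
        refine and_congr_right fun hw => ?_
        have hxY : x ∈ Y := by
          rw [← cs.simple_mem_standardParabolic_iff, ← hl]
          exact mul_mem (mul_mem (inv_mem hw) hyY) hw
        exact Subgroup.mul_mem_cancel_left _ (gen_mem_parabolic ⟨hx, hxY⟩)
      · obtain ⟨h3, h4⟩ := stepPerm_of_not_label cs w h hl
        rw [h3, h4, Subgroup.mul_mem_cancel_left _ hyY]
    | one => simp
    | mul g g' _ _ ih ih' =>
      intro p
      rw [map_mul, Equiv.Perm.mul_apply, ih, ih']
    | inv g _ ih =>
      intro p
      rw [← ih, ← Equiv.Perm.mul_apply, ← map_mul, mul_inv_cancel, map_one, Equiv.Perm.one_apply]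
  have h3 := (h2 (⟨1, fun x _ => cs.invSign_one _⟩, 1)).2 ⟨one_mem _, one_mem _⟩
  rw [h1, mul_one] at h3
  exact h3.2

end ArtinGroup

namespace CoxeterSystem

variable {B W : Type*} [Group W] {M : CoxeterMatrix B} (cs : CoxeterSystem M W)

/-! ### Roots as signed reflections -/

/-- The roots of a Coxeter system, encoded as signed reflections. -/
@[ext]
structure Root where
  /-- The reflection of the root. -/
  refl : W
  /-- The underlying element is a reflection. -/
  isReflection : cs.IsReflection refl
  /-- The sign of the root. -/
  sign : ℤˣ

noncomputable instance : MulAction W cs.Root where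
  smul w β := ⟨w * β.refl * w⁻¹, β.isReflection.conj w, β.sign * cs.invSign w β.refl⟩
  one_smul β := by
    ext1
    · change 1 * β.refl * 1⁻¹ = _; group
    · change β.sign * cs.invSign 1 β.refl = _; rw [invSign_one, mul_one]
  mul_smul u w β := by
    ext1
    · change u * w * β.refl * (u * w)⁻¹ = u * (w * β.refl * w⁻¹) * u⁻¹; group
    · change β.sign * cs.invSign (u * w) β.refl =
        β.sign * cs.invSign w β.refl * cs.invSign u (w * β.refl * w⁻¹)
      rw [invSign_mul, mul_assoc β.sign]

variable {cs}

theorem smul_refl (w : W) (β : cs.Root) : (w • β).refl = w * β.refl * w⁻¹ := rfl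

theorem smul_sign (w : W) (β : cs.Root) : (w • β).sign = β.sign * cs.invSign w β.refl := rfl

variable (cs)

/-- The simple root of a simple reflection. -/
noncomputable def simpleRoot (i : B) : cs.Root := ⟨cs.simple i, cs.isReflection_simple i, 1⟩

theorem simpleRoot_injective : Function.Injective cs.simpleRoot := fun _ _ h =>
  cs.simple_injective (congrArg Root.refl h)

theorem smul_simpleRoot_eq_iff {w : W} {i : B} {β : cs.Root} : w • cs.simpleRoot i = β ↔
    w * cs.simple i * w⁻¹ = β.refl ∧ cs.invSign w (cs.simple i) = β.sign := by
  rw [Root.ext_iff, smul_refl, smul_sign, simpleRoot, one_mul]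

theorem exists_smul_simpleRoot_eq {X : Set B} {β : cs.Root}
    (h : β.refl ∈ cs.standardParabolic X) :
    ∃ w ∈ cs.standardParabolic X, ∃ i ∈ X, w • cs.simpleRoot i = β := by
  obtain ⟨w, hw, i, hi, hβ⟩ := cs.exists_conj_of_mem_standardParabolic β.isReflection h
  by_cases hs : cs.invSign w (cs.simple i) = β.sign
  · exact ⟨w, hw, i, hi, cs.smul_simpleRoot_eq_iff.2 ⟨hβ.symm, hs⟩⟩
  · refine ⟨w * cs.simple i, mul_mem hw (cs.simple_mem_standardParabolic hi), i, hi,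
      cs.smul_simpleRoot_eq_iff.2 ⟨?_, ?_⟩⟩
    · rw [hβ]; group
    · rw [invSign_mul, invSign_simple, eqSign_self, mul_inv_cancel_right]
      obtain h1 | h1 := Int.units_eq_one_or (cs.invSign w (cs.simple i)) <;>
        obtain h2 | h2 := Int.units_eq_one_or β.sign <;> rw [h1, h2] at hs ⊢ <;> simp_all

theorem exists_smul_simpleRoot_eq' (β : cs.Root) : ∃ (w : W) (i : B), w • cs.simpleRoot i = β := by
  have : β.refl ∈ cs.standardParabolic Set.univ := by
    rw [standardParabolic, Set.image_univ, cs.subgroup_closure_range_simple]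
    exact Subgroup.mem_top _
  obtain ⟨w, -, i, -, h⟩ := cs.exists_smul_simpleRoot_eq this
  exact ⟨w, i, h⟩

/-- Two roots are jointly conjugate to simple roots. -/
def JointlySimple (β γ : cs.Root) : Prop :=
  ∃ (w : W) (i j : B), w • cs.simpleRoot i = β ∧ w • cs.simpleRoot j = γ

theorem orderOf_refl_mul_refl {w : W} {i j : B} :
    orderOf ((w • cs.simpleRoot i).refl * (w • cs.simpleRoot j).refl) = M i j := by
  have : (w • cs.simpleRoot i).refl * (w • cs.simpleRoot j).refl =
      MulAut.conj w (cs.simple i * cs.simple j) := by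
    rw [MulAut.conj_apply, smul_refl, smul_refl]
    simp [simpleRoot, mul_assoc]
  rw [this, MulEquiv.orderOf_eq, orderOf_simple_mul_simple]

open Classical in
/-- The Coxeter matrix over the set of roots. -/
noncomputable def rootMatrix : CoxeterMatrix cs.Root where
  M := Matrix.of fun β γ => if β = γ then 1 else
    if cs.JointlySimple β γ then orderOf (β.refl * γ.refl) else 0
  isSymm := by
    ext β γ
    have h1 : cs.JointlySimple β γ ↔ cs.JointlySimple γ β :=
      ⟨fun ⟨w, i, j, h⟩ => ⟨w, j, i, h.symm⟩, fun ⟨w, i, j, h⟩ => ⟨w, j, i, h.symm⟩⟩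
    have h2 : orderOf (β.refl * γ.refl) = orderOf (γ.refl * β.refl) := by
      rw [← orderOf_inv, mul_inv_rev, β.isReflection.inv, γ.isReflection.inv]
    simp only [Matrix.transpose_apply, Matrix.of_apply, h1, h2, eq_comm (a := β)]
  diagonal β := by simp
  off_diagonal β γ h := by
    simp only [Matrix.of_apply, if_neg h]
    split_ifs with h1
    · obtain ⟨w, i, j, rfl, rfl⟩ := h1
      rw [orderOf_refl_mul_refl]
      exact M.off_diagonal i j (by rintro rfl; exact h rfl)
    · simp

theorem rootMatrix_smul_simpleRoot (w : W) {i j : B} (h : i ≠ j) :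
    cs.rootMatrix (w • cs.simpleRoot i) (w • cs.simpleRoot j) = M i j := by
  have h1 : w • cs.simpleRoot i ≠ w • cs.simpleRoot j :=
    fun h' => h (cs.simpleRoot_injective (MulAction.injective w h'))
  have h2 : cs.JointlySimple (w • cs.simpleRoot i) (w • cs.simpleRoot j) :=
    ⟨w, i, j, rfl, rfl⟩
  rw [← cs.orderOf_refl_mul_refl (w := w)]
  exact (if_neg h1).trans (if_pos h2)

theorem exists_of_rootMatrix_ne_zero {β γ : cs.Root} (h : β ≠ γ) (h0 : cs.rootMatrix β γ ≠ 0) :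
    ∃ (w : W) (i j : B), i ≠ j ∧ w • cs.simpleRoot i = β ∧ w • cs.simpleRoot j = γ ∧
      cs.rootMatrix β γ = M i j := by
  by_cases h1 : cs.JointlySimple β γ
  · obtain ⟨w, i, j, rfl, rfl⟩ := h1
    have hij : i ≠ j := by rintro rfl; exact h rfl
    exact ⟨w, i, j, hij, rfl, rfl, cs.rootMatrix_smul_simpleRoot w hij⟩
  · exact absurd ((if_neg h).trans (if_neg h1)) h0

theorem altProdEnd_smul_simpleRoot {a b : B} (h0 : M a b ≠ 0) :
    altProdEnd (cs.simple a) (cs.simple b) (M a b - 1) • cs.simpleRoot a =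
      cs.simpleRoot (if Even (M a b) then a else b) := by
  have ha := cs.simple_mul_simple_self a
  have hb := cs.simple_mul_simple_self b
  have hE := (altProdEnd_swap_iff ha hb (M a b)).2 (cs.simple_mul_simple_pow a b)
  obtain ⟨m, hm⟩ := Nat.exists_eq_succ_of_ne_zero h0
  rw [smul_simpleRoot_eq_iff]
  constructor
  · rw [hm, altProdEnd_succ (cs.simple b), altProdEnd] at hE
    rw [hm, Nat.succ_sub_one, ← hE, mul_inv_cancel_right]
    simp only [Nat.succ_eq_add_one, Nat.even_add_one, simpleRoot]
    split_ifs <;> rfl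
  · rw [invSign_altProdEnd]
    refine Finset.prod_eq_one fun j hj => (Int.units_eq_one_or _).resolve_right fun h => ?_
    rw [eqSign_eq_neg_one_iff] at h
    have h1 : (cs.simple a * cs.simple b) ^ (j + 1) = 1 := by
      rw [pow_succ', mul_assoc, ← h, ha]
    have h2 := Nat.le_of_dvd (by lia) (orderOf_dvd_of_pow_eq_one h1)
    rw [orderOf_simple_mul_simple] at h2
    rw [Finset.mem_range] at hj
    lia

/-! ### Transporting elements along the root system -/

theorem exists_altProdEnd_add (a b : B) (m k : ℕ) : ∃ y, cs.length y ≤ k ∧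
    altProdEnd (cs.simple a) (cs.simple b) (k + m) =
      y * altProdEnd (cs.simple a) (cs.simple b) m := by
  induction k with
  | zero => exact ⟨1, by simp, by simp⟩
  | succ k ih =>
    obtain ⟨y, hy, h⟩ := ih
    obtain ⟨c, hc⟩ : ∃ c, (if Even (k + m) then cs.simple b else cs.simple a) = cs.simple c := by
      split_ifs
      exacts [⟨b, rfl⟩, ⟨a, rfl⟩]
    refine ⟨cs.simple c * y, ?_, ?_⟩
    · have := cs.length_mul_le (cs.simple c) y
      rw [length_simple] at this
      lia
    · rw [Nat.add_right_comm, altProdEnd, h, hc, mul_assoc]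

theorem length_altProdEnd_le (a b : B) (n : ℕ) :
    cs.length (altProdEnd (cs.simple a) (cs.simple b) n) ≤ n := by
  obtain ⟨y, hy, h⟩ := cs.exists_altProdEnd_add a b 0 n
  rw [add_zero, altProdEnd, mul_one] at h
  rwa [h]

theorem eq_altProdEnd_of_invSign {a b : B} {p : W} (hp : p ∈ cs.standardParabolic {a, b})
    (h : cs.invSign p (cs.simple a) = 1) :
    p = altProdEnd (cs.simple a) (cs.simple b) (cs.length p) := by
  induction hn : cs.length p generalizing a b p with
  | zero => rw [cs.length_eq_zero_iff.1 hn, altProdEnd]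
  | succ n ih =>
    have h1 : p ≠ 1 := by
      rintro rfl
      rw [length_one] at hn
      lia
    obtain ⟨c, hc, hd⟩ := cs.exists_rightDescent_of_mem_standardParabolic hp h1
    obtain rfl | rfl := hc
    · rw [h] at hd
      exact absurd hd (by decide)
    · have hb := cs.length_mul_lt_of_invSign hd
      have hl := cs.isRightDescent_iff.1 hb
      rw [altProdEnd_succ, ← ih (a := c) (b := a) (p := p * cs.simple c),
        simple_mul_simple_cancel_right]
      · rw [Set.pair_comm]
        exact mul_mem hp (cs.simple_mem_standardParabolic (by simp))
      · rw [invSign_eq_one_iff _ (cs.isReflection_simple c), simple_mul_simple_cancel_right]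
        exact hb.le
      · lia

theorem lt_of_invSign_eq_one {a b : B} {p : W} (hp : p ∈ cs.standardParabolic {a, b})
    (h : cs.invSign p (cs.simple a) = 1) (h0 : M a b ≠ 0) : cs.length p < M a b := by
  by_contra! hle
  obtain ⟨m, hm⟩ := Nat.exists_eq_succ_of_ne_zero h0
  obtain ⟨k, hk⟩ := Nat.exists_eq_add_of_le' hle
  obtain ⟨y, hy, hE⟩ := cs.exists_altProdEnd_add a b (M a b) k
  rw [invSign_eq_one_iff _ (cs.isReflection_simple a)] at h
  have e : p * cs.simple a = y * altProdEnd (cs.simple a) (cs.simple b) m := by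
    rw [cs.eq_altProdEnd_of_invSign hp ((cs.invSign_eq_one_iff (cs.isReflection_simple a)).2 h),
      hk, hE, (altProdEnd_swap_iff (cs.simple_mul_simple_self a) (cs.simple_mul_simple_self b)
        (M a b)).2 (cs.simple_mul_simple_pow a b), hm, altProdEnd_succ, mul_assoc, mul_assoc,
      simple_mul_simple_self, mul_one]
  have h1 := cs.length_mul_le y (altProdEnd (cs.simple a) (cs.simple b) m)
  have h2 := cs.length_altProdEnd_le a b m
  rw [← e] at h1
  lia

/-- In a dihedral standard parabolic subgroup, the only nontrivial element taking the simple root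
of `a` to a simple root is the alternating product of length `M a b - 1`. -/
theorem eq_one_or_of_smul_simpleRoot {a b c : B} {p : W}
    (hp : p ∈ cs.standardParabolic {a, b}) (hc : c ∈ ({a, b} : Set B))
    (h : p • cs.simpleRoot a = cs.simpleRoot c) :
    p = 1 ∨ M a b ≠ 0 ∧ p = altProdEnd (cs.simple a) (cs.simple b) (M a b - 1) := by
  have ha := cs.simple_mul_simple_self a
  have hb := cs.simple_mul_simple_self b
  obtain ⟨h1, h2⟩ := cs.smul_simpleRoot_eq_iff.1 h
  change _ = cs.simple c at h1
  change _ = 1 at h2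
  have hpE := cs.eq_altProdEnd_of_invSign hp h2
  have hlt := cs.lt_of_invSign_eq_one hp h2
  by_cases hp1 : p = 1
  · exact Or.inl hp1
  right
  have hn0 : cs.length p ≠ 0 := fun h => hp1 (cs.length_eq_zero_iff.1 h)
  generalize cs.length p = n at *
  have key : M a b ∣ n + 1 ∨ M a b ∣ n := by
    rw [← cs.orderOf_simple_mul_simple, orderOf_dvd_iff_pow_eq_one, orderOf_dvd_iff_pow_eq_one]
    rw [mul_inv_eq_iff_eq_mul] at h1
    by_cases hcn : cs.simple c = if Even n then cs.simple b else cs.simple a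
    · left
      have e := altProdEnd_succ' ha hb n
      rw [altProdEnd, ← hcn, ← hpE, ← h1] at e
      rw [pow_succ', mul_assoc, ← mul_left_cancel e, ha]
    · right
      obtain ⟨k, rfl⟩ := Nat.exists_eq_succ_of_ne_zero hn0
      have hck : cs.simple c = if Even k then cs.simple b else cs.simple a := by
        simp only [Nat.succ_eq_add_one, Nat.even_add_one] at hcn
        obtain rfl | rfl := hc <;> split_ifs at hcn ⊢ <;> simp_all
      have e := altProdEnd_succ' ha hb k
      have e1 : p = cs.simple c * altProdEnd (cs.simple a) (cs.simple b) k := by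
        rw [hpE, hck]; rfl
      nth_rw 2 [e1] at h1
      rw [simple_mul_simple_cancel_left] at h1
      rw [← hpE, ← h1, mul_assoc] at e
      rw [pow_succ', mul_assoc]
      exact mul_eq_left.1 e.symm
  have hM : M a b ≠ 0 := by
    intro h
    rw [h, zero_dvd_iff, zero_dvd_iff] at key
    lia
  have hn := hlt hM
  obtain hd | hd := key
  · have := Nat.le_of_dvd (by lia) hd
    refine ⟨hM, ?_⟩
    rw [hpE]
    congr 1
    lia
  · have := Nat.le_of_dvd (by lia) hd
    lia

section transport

variable {G : Type*} [Group G] (T : W →* G) (σ : B → G)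
  (hσ : ∀ a b, a ≠ b → M a b ≠ 0 →
    σ (if Even (M a b) then a else b) * T (altProdEnd (cs.simple a) (cs.simple b) (M a b - 1)) =
      T (altProdEnd (cs.simple a) (cs.simple b) (M a b - 1)) * σ a)

include hσ in
theorem conj_eq_of_smul_simpleRoot {w : W} {i j : B}
    (h : w • cs.simpleRoot i = cs.simpleRoot j) : T w * σ i = σ j * T w := by
  induction hn : cs.length w using Nat.strong_induction_on generalizing w i with
  | _ n ih =>
  by_cases hw1 : w = 1
  · subst hw1
    rw [one_smul] at h
    rw [cs.simpleRoot_injective h, map_one, one_mul, mul_one]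
  obtain ⟨h1, h2⟩ := cs.smul_simpleRoot_eq_iff.1 h
  change _ = cs.simple j at h1
  change _ = 1 at h2
  obtain ⟨b, hb⟩ := cs.exists_rightDescent_of_ne_one hw1
  have hib : i ≠ b := by
    rintro rfl
    rw [cs.invSign_eq_one_iff (cs.isReflection_simple i)] at h2
    exact absurd hb (not_lt.2 h2)
  obtain ⟨u, p, hp, hw, hu, hmin⟩ := cs.exists_min_mul {i, b} w
  have hiJ := cs.simple_mem_standardParabolic (X := {i, b}) (i := i) (by simp)
  have hbJ := cs.simple_mem_standardParabolic (X := {i, b}) (i := b) (by simp)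
  have hrJ := mul_mem (mul_mem hp hiJ) (inv_mem hp)
  have h3 : u * (p * cs.simple i * p⁻¹) * u⁻¹ = cs.simple j := by
    rw [← h1, hw]; group
  obtain ⟨c, hc, hr⟩ := cs.eq_simple_of_conj_eq_simple hu hrJ h3
  have hu1 := hu _ (cs.simple_mem_standardParabolic hc) (cs.isReflection_simple c)
  rw [hw, invSign_mul, hr, hu1, mul_one] at h2
  rw [hr] at h3
  have hlt : cs.length u < n := hn ▸ (hmin _ hbJ).trans_lt hb
  have e1 := ih _ hlt (cs.smul_simpleRoot_eq_iff.2 ⟨h3, hu1⟩) rfl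
  have hpc : p • cs.simpleRoot i = cs.simpleRoot c := cs.smul_simpleRoot_eq_iff.2 ⟨hr, h2⟩
  have e2 : T p * σ i = σ c * T p := by
    obtain rfl | ⟨hM, hpE⟩ := cs.eq_one_or_of_smul_simpleRoot hp hc hpc
    · rw [one_smul] at hpc
      rw [cs.simpleRoot_injective hpc, map_one, one_mul, mul_one]
    · have := cs.altProdEnd_smul_simpleRoot hM
      rw [← hpE, hpc] at this
      rw [cs.simpleRoot_injective this, hpE]
      exact (hσ i b hib hM).symm
  rw [hw, map_mul, mul_assoc, e2, ← mul_assoc, e1, mul_assoc]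

/-- The conjugate of a generator attached to a root. -/
noncomputable def rootElt (β : cs.Root) : G :=
  T (cs.exists_smul_simpleRoot_eq' β).choose *
    σ (cs.exists_smul_simpleRoot_eq' β).choose_spec.choose *
      (T (cs.exists_smul_simpleRoot_eq' β).choose)⁻¹

include hσ in
theorem rootElt_smul_simpleRoot (w : W) (i : B) :
    cs.rootElt T σ (w • cs.simpleRoot i) = T w * σ i * (T w)⁻¹ := by
  have h := (cs.exists_smul_simpleRoot_eq' (w • cs.simpleRoot i)).choose_spec.choose_spec
  unfold rootElt
  generalize (cs.exists_smul_simpleRoot_eq' (w • cs.simpleRoot i)).choose_spec.choose = j at *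
  generalize (cs.exists_smul_simpleRoot_eq' (w • cs.simpleRoot i)).choose = v at *
  have h1 : (w⁻¹ * v) • cs.simpleRoot j = cs.simpleRoot i := by
    rw [mul_smul, h, inv_smul_smul]
  have h2 := cs.conj_eq_of_smul_simpleRoot T σ hσ h1
  rw [map_mul, map_inv, mul_assoc, inv_mul_eq_iff_eq_mul] at h2
  rw [h2]
  group

/-- The homomorphism from the Artin group over the roots that takes a root to the attached
conjugate of a generator. -/
noncomputable def rootHom (hbraid : ∀ a b, a ≠ b → M a b ≠ 0 →
    altProdEnd (σ a) (σ b) (M a b) = altProdEnd (σ b) (σ a) (M a b)) :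
    ArtinGroup cs.rootMatrix →* G :=
  ArtinGroup.lift (cs.rootElt T σ) (by
    intro β γ hne h0
    obtain ⟨w, i, j, hij, rfl, rfl, hM⟩ := cs.exists_of_rootMatrix_ne_zero hne h0
    have h (k : B) : cs.rootElt T σ (w • cs.simpleRoot k) =
        (MulAut.conj (T w)).toMonoidHom (σ k) := cs.rootElt_smul_simpleRoot T σ hσ w k
    rw [hM] at h0 ⊢
    rw [h, h, ← map_altProdEnd, ← map_altProdEnd, hbraid i j hij h0])

end transport

/-! ### The action on the Artin group over the roots -/

theorem rootMatrix_smul (w : W) (β γ : cs.Root) :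
    cs.rootMatrix (w • β) (w • γ) = cs.rootMatrix β γ := by
  have key (w : W) (β γ : cs.Root) (h0 : cs.rootMatrix β γ ≠ 0) :
      cs.rootMatrix (w • β) (w • γ) = cs.rootMatrix β γ := by
    by_cases h : β = γ
    · rw [h, CoxeterMatrix.diagonal, CoxeterMatrix.diagonal]
    · obtain ⟨v, i, j, hij, rfl, rfl, hM⟩ := cs.exists_of_rootMatrix_ne_zero h h0
      rw [hM, ← mul_smul, ← mul_smul, rootMatrix_smul_simpleRoot _ _ hij]
  by_cases h0 : cs.rootMatrix β γ = 0
  · by_contra h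
    rw [h0] at h
    have := key w⁻¹ _ _ h
    rw [inv_smul_smul, inv_smul_smul] at this
    exact h (this.symm.trans h0)
  · exact key w β γ h0

/-- The endomorphism of the Artin group over the roots induced by an element of the Coxeter
group. -/
noncomputable def rootEnd (w : W) : ArtinGroup cs.rootMatrix →* ArtinGroup cs.rootMatrix :=
  ArtinGroup.lift (fun β => ArtinGroup.gen cs.rootMatrix (w • β)) (by
    intro β γ hne h0
    rw [← cs.rootMatrix_smul w] at h0 ⊢
    exact ArtinGroup.braid (fun h => hne (MulAction.injective w h)) h0)

theorem rootEnd_gen (w : W) (β : cs.Root) :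
    cs.rootEnd w (ArtinGroup.gen _ β) = ArtinGroup.gen _ (w • β) := ArtinGroup.lift_gen _ _ _

theorem rootEnd_comp {u w : W} : (cs.rootEnd u).comp (cs.rootEnd w) = cs.rootEnd (u * w) :=
  ArtinGroup.hom_ext fun β => by
    rw [MonoidHom.comp_apply, rootEnd_gen, rootEnd_gen, rootEnd_gen, mul_smul]

theorem rootEnd_one : cs.rootEnd 1 = MonoidHom.id _ :=
  ArtinGroup.hom_ext fun β => by rw [rootEnd_gen, one_smul, MonoidHom.id_apply]

/-- The action of the Coxeter group on the Artin group over its roots. -/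
noncomputable def rootAut : W →* MulAut (ArtinGroup cs.rootMatrix) where
  toFun w := MonoidHom.toMulEquiv (cs.rootEnd w) (cs.rootEnd w⁻¹)
    (by rw [rootEnd_comp, inv_mul_cancel, rootEnd_one])
    (by rw [rootEnd_comp, mul_inv_cancel, rootEnd_one])
  map_one' := by
    ext g
    exact DFunLike.congr_fun cs.rootEnd_one g
  map_mul' u w := by
    ext g
    exact DFunLike.congr_fun cs.rootEnd_comp.symm g

theorem rootAut_gen (w : W) (β : cs.Root) :
    cs.rootAut w (ArtinGroup.gen _ β) = ArtinGroup.gen _ (w • β) := cs.rootEnd_gen w β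

/-- The roots of a standard parabolic subgroup. -/
def parabolicRoots (X : Set B) : Set cs.Root := {β | β.refl ∈ cs.standardParabolic X}

theorem rootAut_mem {X : Set B} {w : W} (hw : w ∈ cs.standardParabolic X)
    {g : ArtinGroup cs.rootMatrix} (hg : g ∈ ArtinGroup.parabolic _ (cs.parabolicRoots X)) :
    cs.rootAut w g ∈ ArtinGroup.parabolic _ (cs.parabolicRoots X) := by
  induction hg using Subgroup.closure_induction with
  | mem g hg =>
    obtain ⟨β, hβ, rfl⟩ := hg
    rw [rootAut_gen]
    exact ArtinGroup.gen_mem_parabolic (mul_mem (mul_mem hw hβ) (inv_mem hw))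
  | one => rw [map_one]; exact one_mem _
  | mul g g' _ _ ih ih' => rw [map_mul]; exact mul_mem ih ih'
  | inv g _ ih => rw [map_inv]; exact inv_mem ih

end CoxeterSystem

section altProd

variable {G : Type*} [Group G]

theorem map_altProd {H : Type*} [Group H] (f : G →* H) (a b : G) (n : ℕ) :
    f (altProd a b n) = altProd (f a) (f b) n := by
  rw [altProd, altProd, map_list_prod, List.map_map]
  congr 2
  ext i
  simp only [Function.comp_apply]
  split_ifs <;> rfl

theorem altProd_eq_altProdEnd (a b : G) (n : ℕ) :
    altProd a b n = if Even n then altProdEnd a b n else altProdEnd b a n := by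
  induction n with
  | zero => simp [altProd, altProdEnd]
  | succ n ih =>
    have h : altProd a b (n + 1) = altProd a b n * if n % 2 = 0 then a else b := by
      simp [altProd, List.range_succ]
    rw [h, ih, altProdEnd_succ, altProdEnd_succ]
    by_cases he : Even n <;> simp [he, ← Nat.even_iff, Nat.even_add_one]

theorem altProd_swap_iff (a b : G) (n : ℕ) :
    altProd a b n = altProd b a n ↔ altProdEnd a b n = altProdEnd b a n := by
  rw [altProd_eq_altProdEnd, altProd_eq_altProdEnd]
  split_ifs
  exacts [Iff.rfl, eq_comm]

theorem altProd_sub_one_eq {n : ℕ} (h : n ≠ 0) (a b : G) : altProd b a (n - 1) =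
    if Even n then altProdEnd a b (n - 1) else altProdEnd b a (n - 1) := by
  obtain ⟨k, rfl⟩ := Nat.exists_eq_succ_of_ne_zero h
  rw [altProd_eq_altProdEnd]
  by_cases he : Even k <;> simp [he, Nat.even_add_one]

end altProd

namespace VirtualArtinGroup

variable {S : Type*} (M : CoxeterMatrix S)

theorem mk_eq_one {r : FreeGroup (S ⊕ S)} (h : r ∈ vaRels M) :
    (PresentedGroup.mk (vaRels M) r : PresentedGroup (vaRels M)) = 1 :=
  PresentedGroup.one_of_mem h

variable {M}

theorem sigma_braid (s t : S) (h : s ≠ t) (h0 : M s t ≠ 0) :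
    altProdEnd (sigma M s) (sigma M t) (M s t) = altProdEnd (sigma M t) (sigma M s) (M s t) := by
  have := mk_eq_one M (Or.inl (Or.inl (Or.inl ⟨s, t, h, h0, rfl⟩)))
  rw [map_mul, map_inv, map_altProd, map_altProd, mul_inv_eq_one] at this
  exact (altProd_swap_iff (G := VirtualArtinGroup M) _ _ _).1 this

theorem tau_mul_tau (s : S) : tau M s * tau M s = 1 :=
  mk_eq_one M (Or.inl (Or.inl (Or.inr ⟨s, rfl⟩)))

theorem tau_braid (s t : S) (h : s ≠ t) (h0 : M s t ≠ 0) :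
    altProdEnd (tau M s) (tau M t) (M s t) = altProdEnd (tau M t) (tau M s) (M s t) := by
  have := mk_eq_one M (Or.inl (Or.inr ⟨s, t, h, h0, rfl⟩))
  rw [map_mul, map_inv, map_altProd, map_altProd, mul_inv_eq_one] at this
  exact (altProd_swap_iff (G := VirtualArtinGroup M) _ _ _).1 this

theorem sigma_mul_altProd (s t : S) (h : s ≠ t) (h0 : M s t ≠ 0) :
    sigma M s * altProd (tau M t) (tau M s) (M s t - 1) =
      altProd (tau M t) (tau M s) (M s t - 1) * sigma M (if Even (M s t) then s else t) := by
  have := mk_eq_one M (Or.inr ⟨s, t, h, h0, rfl⟩)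
  rw [map_mul, map_inv, map_mul, map_mul, map_altProd, mul_inv_eq_one] at this
  exact this

theorem sigma_mul_altProdEnd (a b : S) (h : a ≠ b) (h0 : M a b ≠ 0) :
    sigma M (if Even (M a b) then a else b) * altProdEnd (tau M a) (tau M b) (M a b - 1) =
      altProdEnd (tau M a) (tau M b) (M a b - 1) * sigma M a := by
  by_cases he : Even (M a b)
  · have := sigma_mul_altProd a b h h0
    rw [altProd_sub_one_eq h0, if_pos he, if_pos he] at this
    rw [if_pos he, this]
  · rw [M.symmetric a b] at he h0 ⊢
    have := sigma_mul_altProd b a h.symm h0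
    rw [altProd_sub_one_eq h0, if_neg he, if_neg he] at this
    rw [if_neg he, this]

/-- The homomorphism out of a virtual Artin group given by elements satisfying its relations. -/
def lift {G : Type*} [Group G] (f g : S → G)
    (hf : ∀ s t, s ≠ t → M s t ≠ 0 →
      altProdEnd (f s) (f t) (M s t) = altProdEnd (f t) (f s) (M s t))
    (hg : ∀ s, g s * g s = 1)
    (hgg : ∀ s t, s ≠ t → M s t ≠ 0 →
      altProdEnd (g s) (g t) (M s t) = altProdEnd (g t) (g s) (M s t))
    (hfg : ∀ a b, a ≠ b → M a b ≠ 0 →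
      f (if Even (M a b) then a else b) * altProdEnd (g a) (g b) (M a b - 1) =
        altProdEnd (g a) (g b) (M a b - 1) * f a) : VirtualArtinGroup M →* G :=
  PresentedGroup.toGroup (rels := vaRels M) (f := Sum.elim f g) (by
    rintro r (((⟨s, t, h, h0, rfl⟩ | ⟨s, rfl⟩) | ⟨s, t, h, h0, rfl⟩) | ⟨s, t, h, h0, rfl⟩)
    · rw [map_mul, map_inv, map_altProd, map_altProd, mul_inv_eq_one, altProd_swap_iff]
      simpa using hf s t h h0
    · simpa using hg s
    · rw [map_mul, map_inv, map_altProd, map_altProd, mul_inv_eq_one, altProd_swap_iff]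
      simpa using hgg s t h h0
    · rw [map_mul, map_inv, map_mul, map_mul, map_altProd, mul_inv_eq_one]
      simp only [FreeGroup.lift_apply_of, Sum.elim_inl, Sum.elim_inr]
      rw [altProd_sub_one_eq h0]
      by_cases he : Even (M s t)
      · have := hfg s t h h0
        rw [if_pos he] at this
        rw [if_pos he, if_pos he, this]
      · rw [M.symmetric s t] at he h0 ⊢
        have := hfg t s h.symm h0
        rw [if_neg he] at this
        rw [if_neg he, if_neg he, this])

theorem lift_sigma {G : Type*} [Group G] (f g : S → G) (hf) (hg) (hgg) (hfg) (s : S) :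
    lift (M := M) f g hf hg hgg hfg (sigma M s) = f s :=
  PresentedGroup.toGroup.of (rels := vaRels M) _

theorem lift_tau {G : Type*} [Group G] (f g : S → G) (hf) (hg) (hgg) (hfg) (s : S) :
    lift (M := M) f g hf hg hgg hfg (tau M s) = g s :=
  PresentedGroup.toGroup.of (rels := vaRels M) _

theorem hom_ext {G : Type*} [Group G] {f g : VirtualArtinGroup M →* G}
    (hσ : ∀ s, f (sigma M s) = g (sigma M s)) (hτ : ∀ s, f (tau M s) = g (tau M s)) : f = g :=
  PresentedGroup.ext (rels := vaRels M) (by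
    rintro (s | s)
    exacts [hσ s, hτ s])

variable {W : Type*} [Group W] (cs : CoxeterSystem M W)

/-- The homomorphism from the Coxeter group to the virtual Artin group. -/
def tauHom : W →* VirtualArtinGroup M :=
  cs.lift ⟨tau M, fun a b => by
    by_cases h : a = b
    · rw [h, CoxeterMatrix.diagonal, pow_one, tau_mul_tau]
    · by_cases h0 : M a b = 0
      · rw [h0, pow_zero]
      · exact (altProdEnd_swap_iff (tau_mul_tau a) (tau_mul_tau b) _).1 (tau_braid a b h h0)⟩

theorem tauHom_simple (s : S) : tauHom cs (cs.simple s) = tau M s := cs.lift_apply_simple _ s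

theorem sigma_mul_tauHom (a b : S) (h : a ≠ b) (h0 : M a b ≠ 0) :
    sigma M (if Even (M a b) then a else b) *
        tauHom cs (altProdEnd (cs.simple a) (cs.simple b) (M a b - 1)) =
      tauHom cs (altProdEnd (cs.simple a) (cs.simple b) (M a b - 1)) * sigma M a := by
  rw [map_altProdEnd, tauHom_simple, tauHom_simple, sigma_mul_altProdEnd a b h h0]

/-- The homomorphism from the Artin group over the roots to the virtual Artin group. -/
noncomputable def ofRoots : ArtinGroup cs.rootMatrix →* VirtualArtinGroup M :=
  cs.rootHom (tauHom cs) (sigma M) (sigma_mul_tauHom cs) sigma_braid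

theorem ofRoots_gen (w : W) (s : S) :
    ofRoots cs (ArtinGroup.gen _ (w • cs.simpleRoot s)) =
      tauHom cs w * sigma M s * (tauHom cs w)⁻¹ := by
  rw [ofRoots, CoxeterSystem.rootHom, ArtinGroup.lift_gen,
    cs.rootElt_smul_simpleRoot _ _ (sigma_mul_tauHom cs)]

theorem ofRoots_rootAut (w : W) (g : ArtinGroup cs.rootMatrix) :
    ofRoots cs (cs.rootAut w g) = tauHom cs w * ofRoots cs g * (tauHom cs w)⁻¹ := by
  have : (ofRoots cs).comp (cs.rootAut w).toMonoidHom =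
      (MulAut.conj (tauHom cs w)).toMonoidHom.comp (ofRoots cs) := ArtinGroup.hom_ext fun β => by
    change ofRoots cs (cs.rootAut w (ArtinGroup.gen _ β)) =
      tauHom cs w * ofRoots cs (ArtinGroup.gen _ β) * (tauHom cs w)⁻¹
    obtain ⟨v, s, rfl⟩ := cs.exists_smul_simpleRoot_eq' β
    rw [cs.rootAut_gen, ← mul_smul, ofRoots_gen, ofRoots_gen, map_mul]
    group
  exact DFunLike.congr_fun this g

/-- The homomorphism from the virtual Artin group to the semidirect product of the Artin group
over the roots and the Coxeter group. -/
noncomputable def toSemidirect :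
    VirtualArtinGroup M →* ArtinGroup cs.rootMatrix ⋊[cs.rootAut] W :=
  lift (fun s => SemidirectProduct.inl (ArtinGroup.gen _ (cs.simpleRoot s)))
    (fun s => SemidirectProduct.inr (cs.simple s))
    (fun s t h h0 => by
      have hM := cs.rootMatrix_smul_simpleRoot 1 h
      rw [one_smul, one_smul] at hM
      rw [← map_altProdEnd, ← map_altProdEnd, ← hM,
        ArtinGroup.braid (fun h' => h (cs.simpleRoot_injective h')) (hM ▸ h0)])
    (fun s => by rw [← map_mul, cs.simple_mul_simple_self, map_one])
    (fun s t _ _ => by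
      rw [← map_altProdEnd, ← map_altProdEnd, (altProdEnd_swap_iff (cs.simple_mul_simple_self s)
        (cs.simple_mul_simple_self t) _).2 (cs.simple_mul_simple_pow s t)])
    (fun a b _ h0 => by
      rw [← map_altProdEnd, ← cs.altProdEnd_smul_simpleRoot h0, ← cs.rootAut_gen,
        SemidirectProduct.inl_aut, map_inv, inv_mul_cancel_right])

theorem toSemidirect_sigma (s : S) : toSemidirect cs (sigma M s) =
    SemidirectProduct.inl (ArtinGroup.gen _ (cs.simpleRoot s)) := lift_sigma _ _ _ _ _ _ s

theorem toSemidirect_tau (s : S) : toSemidirect cs (tau M s) =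
    SemidirectProduct.inr (cs.simple s) := lift_tau _ _ _ _ _ _ s

theorem ofRoots_mul_tauHom (g : VirtualArtinGroup M) :
    ofRoots cs (toSemidirect cs g).left * tauHom cs (toSemidirect cs g).right = g := by
  have h1 : ∀ x : ArtinGroup cs.rootMatrix ⋊[cs.rootAut] W,
      SemidirectProduct.lift (ofRoots cs) (tauHom cs)
        (fun w => MonoidHom.ext fun a => ofRoots_rootAut cs w a) x =
      ofRoots cs x.left * tauHom cs x.right := fun _ => rfl
  rw [← h1, ← MonoidHom.comp_apply]
  refine (DFunLike.congr_fun (?_ : _ = MonoidHom.id _) g :)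
  refine hom_ext (fun s => ?_) (fun s => ?_)
  · rw [MonoidHom.comp_apply, toSemidirect_sigma, SemidirectProduct.lift_inl, MonoidHom.id_apply,
      ← one_smul W (cs.simpleRoot s), ofRoots_gen, map_one, one_mul, inv_one, mul_one]
  · rw [MonoidHom.comp_apply, toSemidirect_tau, SemidirectProduct.lift_inr, MonoidHom.id_apply,
      tauHom_simple]

theorem toSemidirect_mem {X : Set S} {g : VirtualArtinGroup M} (hg : g ∈ parabolic M X) :
    (toSemidirect cs g).left ∈ ArtinGroup.parabolic _ (cs.parabolicRoots X) ∧
      (toSemidirect cs g).right ∈ cs.standardParabolic X := by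
  induction hg using Subgroup.closure_induction with
  | mem g hg =>
    obtain ⟨s, hs, rfl⟩ | ⟨s, hs, rfl⟩ := hg
    · simp only [toSemidirect_sigma, SemidirectProduct.left_inl, SemidirectProduct.right_inl]
      exact ⟨ArtinGroup.gen_mem_parabolic (cs.simple_mem_standardParabolic hs), one_mem _⟩
    · simp only [toSemidirect_tau, SemidirectProduct.left_inr, SemidirectProduct.right_inr]
      exact ⟨one_mem _, cs.simple_mem_standardParabolic hs⟩
  | one =>
    rw [map_one]
    exact ⟨one_mem _, one_mem _⟩
  | mul g g' _ _ ih ih' =>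
    rw [map_mul, SemidirectProduct.mul_left, SemidirectProduct.mul_right]
    exact ⟨mul_mem ih.1 (cs.rootAut_mem ih.2 ih'.1), mul_mem ih.2 ih'.2⟩
  | inv g _ ih =>
    rw [map_inv, SemidirectProduct.inv_left, SemidirectProduct.inv_right]
    exact ⟨cs.rootAut_mem (inv_mem ih.2) (inv_mem ih.1), inv_mem ih.2⟩

theorem tauHom_mem {X : Set S} {w : W} (hw : w ∈ cs.standardParabolic X) :
    tauHom cs w ∈ parabolic M X := by
  have : cs.standardParabolic X ≤ (parabolic M X).comap (tauHom cs) := by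
    refine (Subgroup.closure_le _).2 ?_
    rintro _ ⟨s, hs, rfl⟩
    change tauHom cs (cs.simple s) ∈ parabolic M X
    rw [tauHom_simple]
    exact Subgroup.subset_closure (Or.inr ⟨s, hs, rfl⟩)
  exact this hw

theorem ofRoots_mem {X : Set S} {g : ArtinGroup cs.rootMatrix}
    (hg : g ∈ ArtinGroup.parabolic _ (cs.parabolicRoots X)) : ofRoots cs g ∈ parabolic M X := by
  have : ArtinGroup.parabolic _ (cs.parabolicRoots X) ≤ (parabolic M X).comap (ofRoots cs) := by
    refine (Subgroup.closure_le _).2 ?_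
    rintro _ ⟨β, hβ, rfl⟩
    obtain ⟨w, hw, s, hs, rfl⟩ := cs.exists_smul_simpleRoot_eq hβ
    change ofRoots cs _ ∈ parabolic M X
    rw [ofRoots_gen]
    have hw' := tauHom_mem cs hw
    exact mul_mem (mul_mem hw' (Subgroup.subset_closure (Or.inl ⟨s, hs, rfl⟩))) (inv_mem hw')
  exact this hg

include cs in
theorem parabolic_inf_le (X Y : Set S) :
    parabolic M X ⊓ parabolic M Y ≤ parabolic M (X ∩ Y) := by
  rintro g ⟨hX, hY⟩
  obtain ⟨hX1, hX2⟩ := toSemidirect_mem cs hX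
  obtain ⟨hY1, hY2⟩ := toSemidirect_mem cs hY
  have h1 := ArtinGroup.parabolic_inf_le cs.rootMatrix.toCoxeterSystem _ _ ⟨hX1, hY1⟩
  have h2 : cs.parabolicRoots X ∩ cs.parabolicRoots Y = cs.parabolicRoots (X ∩ Y) := by
    ext β
    change β.refl ∈ cs.standardParabolic X ⊓ cs.standardParabolic Y ↔ _
    rw [cs.standardParabolic_inf]
    rfl
  rw [h2] at h1
  rw [← ofRoots_mul_tauHom cs g]
  exact mul_mem (ofRoots_mem cs h1) (tauHom_mem cs (cs.standardParabolic_inf X Y ▸ ⟨hX2, hY2⟩))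

end VirtualArtinGroup

/-- **Theorem 1.2.** The intersection of two standard parabolic subgroups of a virtual Artin
group is the standard parabolic subgroup of the intersection: `VA_X[Γ] ∩ VA_Y[Γ] = VA_{X∩Y}[Γ]`. -/
theorem va_parabolic_inter {S : Type*} [Fintype S] [DecidableEq S]
    (M : CoxeterMatrix S) (X Y : Set S) :
    VirtualArtinGroup.parabolic M X ⊓ VirtualArtinGroup.parabolic M Y =
      VirtualArtinGroup.parabolic M (X ∩ Y) := by
  refine le_antisymm (VirtualArtinGroup.parabolic_inf_le M.toCoxeterSystem X Y) (le_inf ?_ ?_)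
  · exact Subgroup.closure_mono (Set.union_subset_union (Set.image_mono Set.inter_subset_left)
      (Set.image_mono Set.inter_subset_left))
  · exact Subgroup.closure_mono (Set.union_subset_union (Set.image_mono Set.inter_subset_right)
      (Set.image_mono Set.inter_subset_right))
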